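/- No fullerene graph has minimum pentagonal ring length exactly 7: if a fullerene graph F contains a pentagonal ring of length 7, then F also contains a pentagonal ring of length at most 6. -/

import Mathlib

open SimpleGraph

/-- The set of vertices incident with some edge of a face boundary. -/
def faceVerts (f : Finset (Sym2 V)) : Set V := {v | ∃ e ∈ f, v ∈ e}

/-- `G` has a perfect matching. -/
def HasPM (G : SimpleGraph V) : Prop := ∃ M : G.Subgraph, M.IsPerfectMatching

/-- Number of odd connected components of `G`. -/
noncomputable def oddComponents (G : SimpleGraph V) : ℕ :=
  Nat.card {c : G.ConnectedComponent // Odd (Nat.card c.supp)}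

/-- `G` is cyclically `k`-edge-connected: no set of fewer than `k` edges
separates `G` into two parts each containing a cycle. -/
def CycEdgeConn (G : SimpleGraph V) (k : ℕ) : Prop :=
  ∀ D : Finset (Sym2 V), D.card < k →
    ¬ ∃ A : Set V, (∀ a ∈ A, ∀ b ∉ A, ¬ (G.deleteEdges (↑D : Set (Sym2 V))).Adj a b) ∧
      ¬ (G.induce A).IsAcyclic ∧ ¬ (G.induce Aᶜ).IsAcyclic

/-- A combinatorial fullerene: a cubic, 3-connected plane graph presented together with
its face boundaries (as edge sets of boundary cycles), every face a pentagon or a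
hexagon, each edge on exactly two faces, Euler's formula, and exactly 12 pentagons. -/
structure IsFullerene [Fintype V] [DecidableEq V] (G : SimpleGraph V)
    (faces : Finset (Finset (Sym2 V))) : Prop where
  cubic : ∀ v : V, (G.neighborSet v).ncard = 3
  card_ge : 4 ≤ Fintype.card V
  threeConnected : ∀ s : Set V, s.ncard ≤ 2 → (G.induce sᶜ).Connected
  face_cycle : ∀ f ∈ faces, ∃ (v : V) (c : G.Walk v v), c.IsCycle ∧ c.edges.toFinset = f
  face_size : ∀ f ∈ faces, f.card = 5 ∨ f.card = 6
  edge_two_faces : ∀ e ∈ G.edgeSet, (faces.filter (fun f => e ∈ f)).card = 2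
  euler : Fintype.card V + faces.card = G.edgeSet.ncard + 2
  pentagons : (faces.filter (fun f => f.card = 5)).card = 12
/-- A pentagonal ring of length `l`: a cyclic sequence of pentagonal faces,
consecutive faces sharing exactly one edge, non-consecutive faces vertex-disjoint,
and the shared edges forming a matching. -/
def IsPentagonalRing [DecidableEq V] (faces : Finset (Finset (Sym2 V)))
    (l : ℕ) (ring : ZMod l → Finset (Sym2 V)) : Prop :=
  3 ≤ l ∧ Function.Injective ring ∧
  (∀ i, ring i ∈ faces ∧ (ring i).card = 5) ∧
  (∀ i, ∃ e, ring i ∩ ring (i + 1) = {e}) ∧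
  (∀ i j : ZMod l, j ≠ i → j ≠ i + 1 → j ≠ i - 1 →
    Disjoint (faceVerts (ring i)) (faceVerts (ring j))) ∧
  (∀ i j : ZMod l, i ≠ j → ∀ e ∈ ring i ∩ ring (i + 1), ∀ e' ∈ ring j ∩ ring (j + 1),
    ∀ v : V, v ∈ e → v ∉ e')

namespace IsFullerene

variable {V : Type*} [Fintype V] [DecidableEq V] {G : SimpleGraph V}
  {faces : Finset (Finset (Sym2 V))}

lemma mem_edgeSet (hF : IsFullerene G faces) {f : Finset (Sym2 V)} (hf : f ∈ faces)
    {e : Sym2 V} (he : e ∈ f) : e ∈ G.edgeSet := by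
  obtain ⟨v, c, -, rfl⟩ := hF.face_cycle f hf
  exact c.edges_subset_edgeSet (by simpa using he)

/-- A face has exactly two edges at each of its vertices. -/
lemma exists_other_edge (hF : IsFullerene G faces) {f : Finset (Sym2 V)} (hf : f ∈ faces)
    {e : Sym2 V} (he : e ∈ f) {v : V} (hv : v ∈ e) :
    ∃ e' ∈ f, e' ≠ e ∧ v ∈ e' ∧ ∀ e'' ∈ f, v ∈ e'' → e'' = e ∨ e'' = e' := by
  obtain ⟨u, c, hc, rfl⟩ := hF.face_cycle f hf
  obtain ⟨w, rfl⟩ := hv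
  simp only [List.mem_toFinset] at he ⊢
  have hadj : ∀ z, z ∈ c.toSubgraph.neighborSet v ↔ s(v, z) ∈ c.edges := by
    intro z
    rw [Subgraph.mem_neighborSet, ← Subgraph.mem_edgeSet, Walk.mem_edges_toSubgraph]
  have h2 := hc.ncard_neighborSet_toSubgraph_eq_two (c.fst_mem_support_of_mem_edges he)
  obtain ⟨a, b, hab, hN⟩ := Set.ncard_eq_two.mp h2
  simp only [hN, Set.mem_insert_iff, Set.mem_singleton_iff] at hadj
  have key : ∀ z z', z ≠ z' → (∀ y, (y = z ∨ y = z') ↔ s(v, y) ∈ c.edges) → w = z →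
      ∃ e' ∈ c.edges, e' ≠ s(v, w) ∧ v ∈ e' ∧
        ∀ e'' ∈ c.edges, v ∈ e'' → e'' = s(v, w) ∨ e'' = e' := by
    rintro z z' hz hzz rfl
    refine ⟨s(v, z'), (hzz z').mp (Or.inr rfl), ?_, by simp, ?_⟩
    · exact fun h => hz (Sym2.congr_right.mp h).symm
    · rintro e'' h'' ⟨y, rfl⟩
      rcases (hzz y).mpr h'' with rfl | rfl <;> simp
  rcases (hadj w).mpr he with h | h
  · exact key a b hab hadj h
  · exact key b a hab.symm (fun y => by rw [or_comm]; exact hadj y) h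

/-- Two edges at a vertex are complemented by exactly one third edge. -/
lemma exists_third_edge (hF : IsFullerene G faces) {v : V} {e₁ e₂ : Sym2 V}
    (h₁ : e₁ ∈ G.edgeSet) (h₂ : e₂ ∈ G.edgeSet) (hv₁ : v ∈ e₁) (hv₂ : v ∈ e₂) (h : e₁ ≠ e₂) :
    ∃ e₃ ∈ G.edgeSet, v ∈ e₃ ∧ e₃ ≠ e₁ ∧ e₃ ≠ e₂ ∧
      ∀ e ∈ G.edgeSet, v ∈ e → e = e₁ ∨ e = e₂ ∨ e = e₃ := by
  obtain ⟨a, rfl⟩ := hv₁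
  obtain ⟨b, rfl⟩ := hv₂
  have hab : a ≠ b := by rintro rfl; exact h rfl
  obtain ⟨x, y, z, hxy, hxz, hyz, hN⟩ := Set.ncard_eq_three.mp (hF.cubic v)
  have hadj : ∀ w, G.Adj v w ↔ w = x ∨ w = y ∨ w = z := by
    intro w
    rw [← mem_neighborSet, hN]; simp
  have ha := (hadj a).mp h₁
  have hb := (hadj b).mp h₂
  obtain ⟨c, hca, hcb, hc⟩ : ∃ c, c ≠ a ∧ c ≠ b ∧ ∀ w, G.Adj v w ↔ w = a ∨ w = b ∨ w = c := by
    simp only [hadj]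
    rcases ha with rfl | rfl | rfl <;> rcases hb with rfl | rfl | rfl <;>
      first
      | exact absurd rfl hab
      | exact ⟨x, by tauto, by tauto, by tauto⟩
      | exact ⟨y, by tauto, by tauto, by tauto⟩
      | exact ⟨z, by tauto, by tauto, by tauto⟩
  refine ⟨s(v, c), (hc c).mpr (by simp), by simp, fun h => hca (Sym2.congr_right.mp h),
    fun h => hcb (Sym2.congr_right.mp h), ?_⟩
  rintro e he ⟨w, rfl⟩
  rcases (hc w).mp he with rfl | rfl | rfl <;> simp

/-- The faces at an edge of a vertex split according to the second edge they use there. -/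
lemma card_corner_add (hF : IsFullerene G faces) {v : V} {e₁ e₂ e₃ : Sym2 V}
    (h₁ : e₁ ∈ G.edgeSet) (hv₁ : v ∈ e₁) (hv₂ : v ∈ e₂) (hv₃ : v ∈ e₃)
    (h₁₂ : e₁ ≠ e₂) (h₁₃ : e₁ ≠ e₃) (h₂₃ : e₂ ≠ e₃)
    (hall : ∀ e ∈ G.edgeSet, v ∈ e → e = e₁ ∨ e = e₂ ∨ e = e₃) :
    (faces.filter (fun f => e₁ ∈ f ∧ e₂ ∈ f)).card
      + (faces.filter (fun f => e₁ ∈ f ∧ e₃ ∈ f)).card = 2 := by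
  rw [← hF.edge_two_faces e₁ h₁,
    ← Finset.card_filter_add_card_filter_not (s := faces.filter (fun f => e₁ ∈ f))
      (fun f => e₂ ∈ f), Finset.filter_filter, Finset.filter_filter]
  congr 2
  refine Finset.filter_congr fun f hf => and_congr_right fun he₁ => ?_
  obtain ⟨e', he', hne, hv', huniq⟩ := hF.exists_other_edge hf he₁ hv₁
  constructor
  · intro h3 h2
    rcases huniq _ h3 hv₃ with h | h <;> rcases huniq _ h2 hv₂ with h' | h'
    · exact h₁₃ h.symm
    · exact h₁₃ h.symm
    · exact h₁₂ h'.symm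
    · exact h₂₃ (h'.trans h.symm)
  · intro h2
    rcases hall e' (hF.mem_edgeSet hf he') hv' with h | h | h
    · exact absurd h hne
    · exact absurd (h ▸ he') h2
    · exact h ▸ he'

lemma card_corner (hF : IsFullerene G faces) {v : V} {e₁ e₂ : Sym2 V}
    (h₁ : e₁ ∈ G.edgeSet) (h₂ : e₂ ∈ G.edgeSet) (hv₁ : v ∈ e₁) (hv₂ : v ∈ e₂) (h : e₁ ≠ e₂) :
    (faces.filter (fun f => e₁ ∈ f ∧ e₂ ∈ f)).card = 1 := by
  obtain ⟨e₃, h₃, hv₃, h₃₁, h₃₂, hall⟩ := hF.exists_third_edge h₁ h₂ hv₁ hv₂ h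
  have a := hF.card_corner_add h₁ hv₁ hv₂ hv₃ h h₃₁.symm h₃₂.symm hall
  have b := hF.card_corner_add h₂ hv₂ hv₁ hv₃ h.symm h₃₂.symm h₃₁.symm
    (fun e he hv => by have := hall e he hv; tauto)
  have c := hF.card_corner_add h₃ hv₃ hv₁ hv₂ h₃₁ h₃₂ h
    (fun e he hv => by have := hall e he hv; tauto)
  have symm : ∀ e e' : Sym2 V, (faces.filter (fun f => e ∈ f ∧ e' ∈ f)).card
      = (faces.filter (fun f => e' ∈ f ∧ e ∈ f)).card :=
    fun e e' => by simp only [and_comm]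
  rw [symm e₂ e₁] at b
  rw [symm e₃ e₁, symm e₃ e₂] at c
  omega

lemma exists_corner (hF : IsFullerene G faces) {v : V} {e₁ e₂ : Sym2 V}
    (h₁ : e₁ ∈ G.edgeSet) (h₂ : e₂ ∈ G.edgeSet) (hv₁ : v ∈ e₁) (hv₂ : v ∈ e₂) (h : e₁ ≠ e₂) :
    ∃ f ∈ faces, e₁ ∈ f ∧ e₂ ∈ f := by
  obtain ⟨f, hf⟩ := Finset.card_eq_one.mp (hF.card_corner h₁ h₂ hv₁ hv₂ h)
  have := Finset.mem_filter.mp (hf ▸ Finset.mem_singleton_self f)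
  exact ⟨f, this⟩

lemma corner_unique (hF : IsFullerene G faces) {v : V} {e₁ e₂ : Sym2 V}
    (hv₁ : v ∈ e₁) (hv₂ : v ∈ e₂) (h : e₁ ≠ e₂) {f f' : Finset (Sym2 V)} (hf : f ∈ faces)
    (hf' : f' ∈ faces) (h₁ : e₁ ∈ f) (h₂ : e₂ ∈ f) (h₁' : e₁ ∈ f') (h₂' : e₂ ∈ f') : f = f' :=
  Finset.card_le_one.mp
    (hF.card_corner (hF.mem_edgeSet hf h₁) (hF.mem_edgeSet hf h₂) hv₁ hv₂ h).le _
    (Finset.mem_filter.mpr ⟨hf, h₁, h₂⟩) _ (Finset.mem_filter.mpr ⟨hf', h₁', h₂'⟩)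

lemma eq_or_eq_of_mem (hF : IsFullerene G faces) {e : Sym2 V} {f f' f'' : Finset (Sym2 V)}
    (hf : f ∈ faces) (hf' : f' ∈ faces) (hf'' : f'' ∈ faces) (he : e ∈ f) (he' : e ∈ f')
    (he'' : e ∈ f'') (h : f ≠ f') : f'' = f ∨ f'' = f' := by
  obtain ⟨a, b, -, hab⟩ := Finset.card_eq_two.mp (hF.edge_two_faces e (hF.mem_edgeSet hf he))
  have key : ∀ x ∈ faces, e ∈ x → x = a ∨ x = b := by
    intro x hx hex
    have : x ∈ faces.filter (fun f => e ∈ f) := Finset.mem_filter.mpr ⟨hx, hex⟩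
    simpa [hab] using this
  have h1 := key f hf he
  have h2 := key f' hf' he'
  have h3 := key f'' hf'' he''
  grind

/-- Two faces with a common vertex have a common edge at that vertex. -/
lemma exists_common_edge (hF : IsFullerene G faces) {f f' : Finset (Sym2 V)} (hf : f ∈ faces)
    (hf' : f' ∈ faces) {v : V} (hv : v ∈ faceVerts f) (hv' : v ∈ faceVerts f') :
    ∃ e ∈ f, e ∈ f' ∧ v ∈ e := by
  obtain ⟨a, ha, hva⟩ := hv
  obtain ⟨b, hb, hvb⟩ := hv'
  obtain ⟨a', ha', hne, hva', -⟩ := hF.exists_other_edge hf ha hva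
  obtain ⟨b', hb', hne', hvb', -⟩ := hF.exists_other_edge hf' hb hvb
  obtain ⟨c, -, -, -, -, hall⟩ := hF.exists_third_edge (hF.mem_edgeSet hf ha)
    (hF.mem_edgeSet hf ha') hva hva' hne.symm
  have h1 := hall b (hF.mem_edgeSet hf' hb) hvb
  have h2 := hall b' (hF.mem_edgeSet hf' hb') hvb'
  grind

/-- A nearly full set of edges of a face that is closed under passing to the other edge at each
of its vertices is the whole face. -/
lemma eq_of_closed (hF : IsFullerene G faces) {f H : Finset (Sym2 V)} (hf : f ∈ faces)
    (hH : H ⊆ f) (hcl : ∀ e ∈ H, ∀ v ∈ e, ∃ e' ∈ H, e' ≠ e ∧ v ∈ e')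
    (hcard : f.card ≤ H.card + 2) : f = H := by
  by_contra hne
  obtain ⟨e, he, heH⟩ : ∃ e ∈ f, e ∉ H := by
    by_contra! hcon
    exact hne (Finset.Subset.antisymm hcon hH)
  have out : ∀ e ∈ f, e ∉ H → ∀ v ∈ e, ∃ e' ∈ f, e' ∉ H ∧ e' ≠ e ∧ v ∈ e' := by
    intro e he heH v hv
    obtain ⟨e', he', hne', hv', huniq⟩ := hF.exists_other_edge hf he hv
    refine ⟨e', he', fun h' => ?_, hne', hv'⟩
    obtain ⟨e'', h'', hne'', hv''⟩ := hcl e' h' v hv'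
    rcases huniq e'' (hH h'') hv'' with rfl | rfl
    · exact heH h''
    · exact hne'' rfl
  induction e using Sym2.ind with
  | _ u w =>
  have huw : u ≠ w := by
    have := hF.mem_edgeSet hf he
    exact G.ne_of_adj this
  obtain ⟨a, ha, haH, hae, hua⟩ := out _ he heH u (by simp)
  obtain ⟨b, hb, hbH, hbe, hwb⟩ := out _ he heH w (by simp)
  have hab : a ≠ b := by
    rintro rfl
    exact hae ((Sym2.mem_and_mem_iff huw).mp ⟨hua, hwb⟩)
  have hsub : ({s(u, w), a, b} : Finset (Sym2 V)) ⊆ f \ H := by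
    intro x hx
    simp only [Finset.mem_insert, Finset.mem_singleton] at hx
    rcases hx with rfl | rfl | rfl <;> simp [*]
  have h3 : ({s(u, w), a, b} : Finset (Sym2 V)).card = 3 :=
    Finset.card_eq_three.mpr ⟨_, _, _, hae.symm, hbe.symm, hab, rfl⟩
  have := Finset.card_le_card hsub
  rw [Finset.card_sdiff_of_subset hH] at this
  omega

end IsFullerene

namespace IsFullerene

variable {V : Type*} [Fintype V] [DecidableEq V] {G : SimpleGraph V}
  {faces : Finset (Finset (Sym2 V))}

lemma connected (hF : IsFullerene G faces) : G.Connected := by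
  have h := hF.threeConnected ∅ (by simp)
  rw [Set.compl_empty] at h
  exact (induceUnivIso G).connected_iff.mp h

lemma eq_of_adj_invariant (hF : IsFullerene G faces) {α : Type*} (t : V → α)
    (ht : ∀ u w, G.Adj u w → t u = t w) (u w : V) : t u = t w := by
  obtain ⟨p⟩ := hF.connected.preconnected u w
  induction p with
  | nil => rfl
  | cons h _ ih => exact (ht _ _ h).trans ih

lemma exists_mem_faceVerts (hF : IsFullerene G faces) (v : V) :
    ∃ f ∈ faces, v ∈ faceVerts f := by
  have h3 := hF.cubic v
  obtain ⟨w, hw⟩ : (G.neighborSet v).Nonempty := by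
    rw [Set.nonempty_iff_ne_empty]
    intro h
    simp [h] at h3
  have hcard := hF.edge_two_faces s(v, w) hw
  obtain ⟨f, hf⟩ : (faces.filter (fun f => s(v, w) ∈ f)).Nonempty := by
    rw [← Finset.card_pos]
    omega
  rw [Finset.mem_filter] at hf
  exact ⟨f, hf.1, s(v, w), hf.2, by simp⟩

/-- The dual graph of a fullerene is connected. -/
lemma eq_of_dual_invariant (hF : IsFullerene G faces) {α : Type*} (σ : Finset (Sym2 V) → α)
    (hσ : ∀ f ∈ faces, ∀ f' ∈ faces, ∀ e ∈ f, e ∈ f' → σ f = σ f')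
    {f f' : Finset (Sym2 V)} (hf : f ∈ faces) (hf' : f' ∈ faces) : σ f = σ f' := by
  choose φ hφ hφv using hF.exists_mem_faceVerts
  have hloc : ∀ g ∈ faces, ∀ v ∈ faceVerts g, σ g = σ (φ v) := by
    intro g hg v hv
    obtain ⟨e, he, he', -⟩ := hF.exists_common_edge hg (hφ v) hv (hφv v)
    exact hσ g hg _ (hφ v) e he he'
  have hconst := hF.eq_of_adj_invariant (fun v => σ (φ v)) (by
    intro u w huw
    have hcard := hF.edge_two_faces s(u, w) huw
    obtain ⟨g, hg⟩ : (faces.filter (fun f => s(u, w) ∈ f)).Nonempty := by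
      rw [← Finset.card_pos]
      omega
    rw [Finset.mem_filter] at hg
    exact (hloc g hg.1 u ⟨_, hg.2, by simp⟩).symm.trans (hloc g hg.1 w ⟨_, hg.2, by simp⟩))
  have hne : ∀ g ∈ faces, ∃ v, v ∈ faceVerts g := by
    intro g hg
    obtain ⟨e, he⟩ : g.Nonempty := by
      rw [← Finset.card_pos]
      rcases hF.face_size g hg with h | h <;> omega
    exact ⟨e.out.1, e, he, e.out_fst_mem⟩
  obtain ⟨v, hv⟩ := hne f hf
  obtain ⟨v', hv'⟩ := hne f' hf'
  exact (hloc f hf v hv).trans ((hconst v v').trans (hloc f' hf' v' hv').symm)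

/-- Every `ZMod 2`-valued edge labelling with vanishing sum around each face is the coboundary
of a vertex labelling. -/
theorem exists_potential (hF : IsFullerene G faces) (c : Sym2 V → ZMod 2)
    (hc : ∀ f ∈ faces, ∑ e ∈ f, c e = 0) :
    ∃ t : V → ZMod 2, ∀ u w, G.Adj u w → c s(u, w) = t u + t w := by
  classical
  let B : Matrix G.edgeSet V (ZMod 2) :=
    Matrix.of fun e v => if v ∈ e.1 then 1 else 0
  let A : Matrix faces G.edgeSet (ZMod 2) :=
    Matrix.of fun f e => if e.1 ∈ f.1 then 1 else 0
  have hB : ∀ (t : V → ZMod 2) u w (h : G.Adj u w), B.mulVec t ⟨s(u, w), h⟩ = t u + t w := by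
    intro t u w h
    have hfil : (Finset.univ.filter (fun v => v ∈ s(u, w))) = {u, w} := by ext; simp
    simp only [Matrix.mulVec, dotProduct, B, Matrix.of_apply, ite_mul, one_mul, zero_mul]
    rw [← Finset.sum_filter, hfil, Finset.sum_pair h.ne]
  have hA : ∀ (x : Sym2 V → ZMod 2) (f : faces),
      A.mulVec (fun e => x e.1) f = ∑ e ∈ f.1, x e := by
    intro x f
    simp only [Matrix.mulVec, dotProduct, A, Matrix.of_apply, ite_mul, one_mul, zero_mul]
    rw [← Finset.sum_filter]
    refine Finset.sum_bij (fun e _ => e.1) (by simp) (fun a _ b _ h => Subtype.ext h) ?_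
      (fun _ _ => rfl)
    intro e he
    exact ⟨⟨e, hF.mem_edgeSet f.2 he⟩, by simpa using he, rfl⟩
  have hAt : ∀ (σ : faces → ZMod 2) (e : G.edgeSet) (f f' : faces), f ≠ f' → e.1 ∈ f.1 →
      e.1 ∈ f'.1 → A.transpose.mulVec σ e = σ f + σ f' := by
    intro σ e f f' hne he he'
    have hfil : (Finset.univ.filter (fun g : faces => e.1 ∈ g.1)) = {f, f'} := by
      ext g
      simp only [Finset.mem_filter, Finset.mem_univ, true_and, Finset.mem_insert,
        Finset.mem_singleton]
      constructor
      · intro hg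
        have := hF.eq_or_eq_of_mem f.2 f'.2 g.2 he he' hg (fun h => hne (Subtype.ext h))
        exact this.imp Subtype.ext Subtype.ext
      · rintro (rfl | rfl) <;> assumption
    simp only [Matrix.mulVec, dotProduct, A, Matrix.transpose_apply, Matrix.of_apply, ite_mul,
      one_mul, zero_mul]
    rw [← Finset.sum_filter, hfil, Finset.sum_pair hne]
  -- both kernels of the coboundary maps consist of constants
  have kerB : Module.finrank (ZMod 2) (LinearMap.ker B.mulVecLin) ≤ 1 := by
    refine (Submodule.finrank_mono (t := Submodule.span (ZMod 2) {1}) ?_).trans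
      ((finrank_span_le_card _).trans (by simp))
    intro t ht
    have hadj : ∀ u w, G.Adj u w → t u = t w := by
      intro u w h
      rw [← CharTwo.add_eq_zero]
      rw [← hB t u w h]
      exact congrFun ht _
    obtain ⟨v₀⟩ := hF.connected.nonempty
    refine Submodule.mem_span_singleton.mpr ⟨t v₀, ?_⟩
    ext v
    simpa using hF.eq_of_adj_invariant t hadj v₀ v
  have kerAt : Module.finrank (ZMod 2) (LinearMap.ker A.transpose.mulVecLin) ≤ 1 := by
    refine (Submodule.finrank_mono (t := Submodule.span (ZMod 2) {1}) ?_).trans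
      ((finrank_span_le_card _).trans (by simp))
    intro σ hσ
    obtain ⟨v₀⟩ := hF.connected.nonempty
    obtain ⟨f₀, hf₀, -⟩ := hF.exists_mem_faceVerts v₀
    refine Submodule.mem_span_singleton.mpr ⟨σ ⟨f₀, hf₀⟩, ?_⟩
    ext f
    have := hF.eq_of_dual_invariant (fun g => if h : g ∈ faces then σ ⟨g, h⟩ else 0) (by
      intro g hg g' hg' e he he'
      simp only [hg, hg', dif_pos]
      by_cases hgg : g = g'
      · subst hgg; rfl
      · rw [← CharTwo.add_eq_zero]
        rw [← hAt σ ⟨e, hF.mem_edgeSet hg he⟩ ⟨g, hg⟩ ⟨g', hg'⟩ (by simpa using hgg) he he']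
        exact congrFun hσ _) hf₀ f.2
    simpa [hf₀] using this
  have hle : LinearMap.range B.mulVecLin ≤ LinearMap.ker A.mulVecLin := by
    rintro _ ⟨t, rfl⟩
    rw [LinearMap.mem_ker]
    ext f
    let x : Sym2 V → ZMod 2 := fun e => ∑ v, if v ∈ e then t v else 0
    have hx : B.mulVecLin t = fun e => x e.1 := by
      ext e
      rw [Matrix.mulVecLin_apply]
      simp only [Matrix.mulVec, dotProduct, B, Matrix.of_apply, ite_mul, one_mul, zero_mul, x]
    rw [hx, Matrix.mulVecLin_apply, hA]
    simp only [x]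
    rw [Finset.sum_comm]
    refine Finset.sum_eq_zero fun v _ => ?_
    rw [← Finset.sum_filter, Finset.sum_const]
    by_cases hv : ∃ e ∈ f.1, v ∈ e
    · obtain ⟨e, he, hve⟩ := hv
      obtain ⟨e', he', hne, hve', huniq⟩ := hF.exists_other_edge f.2 he hve
      have : f.1.filter (fun e => v ∈ e) = {e, e'} := by
        ext e''
        simp only [Finset.mem_filter, Finset.mem_insert, Finset.mem_singleton]
        constructor
        · exact fun h => huniq _ h.1 h.2
        · rintro (rfl | rfl) <;> exact ⟨‹_›, ‹_›⟩
      rw [this, Finset.card_pair hne.symm, two_nsmul]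
      exact CharTwo.add_self_eq_zero _
    · have : f.1.filter (fun e => v ∈ e) = ∅ := by
        ext e''
        simpa using fun h h' => hv ⟨e'', h, h'⟩
      simp [this]
  have hdim : Module.finrank (ZMod 2) (LinearMap.ker A.mulVecLin)
      ≤ Module.finrank (ZMod 2) (LinearMap.range B.mulVecLin) := by
    have rA := A.mulVecLin.finrank_range_add_finrank_ker
    have rAt := A.transpose.mulVecLin.finrank_range_add_finrank_ker
    have rB := B.mulVecLin.finrank_range_add_finrank_ker
    have hr : Module.finrank (ZMod 2) (LinearMap.range A.transpose.mulVecLin)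
      = Module.finrank (ZMod 2) (LinearMap.range A.mulVecLin) := A.rank_transpose
    have he := hF.euler
    rw [← Nat.card_coe_set_eq, Nat.card_eq_fintype_card] at he
    simp only [Module.finrank_fintype_fun_eq_card, Fintype.card_coe] at rA rAt rB
    omega
  have heq := Submodule.eq_of_le_of_finrank_le hle hdim
  have hmem : (fun e : G.edgeSet => c e.1) ∈ LinearMap.range B.mulVecLin := by
    rw [heq, LinearMap.mem_ker]
    ext f
    rw [Matrix.mulVecLin_apply, hA, hc f.1 f.2]
    rfl
  obtain ⟨t, ht⟩ := hmem
  refine ⟨t, fun u w h => ?_⟩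
  rw [← hB t u w h]
  exact (congrFun ht ⟨s(u, w), h⟩).symm

end IsFullerene

/-- `f` is a pentagon with disjoint edges `xy` and `zw` and fifth vertex `m`, where `m` lies on
the side of `x` and `z` if `b` holds and on the side of `y` and `w` otherwise. -/
structure IsPentagon {V : Type*} [DecidableEq V] (f : Finset (Sym2 V)) (x y z w m : V)
    (b : Bool) : Prop where
  nodup : [x, y, z, w, m].Nodup
  eq : f = bif b then {s(x, y), s(z, w), s(x, m), s(m, z), s(y, w)}
    else {s(x, y), s(z, w), s(x, z), s(y, m), s(m, w)}

lemma IsPentagon.swap {V : Type*} [DecidableEq V] {f : Finset (Sym2 V)} {x y z w m : V}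
    {b : Bool} (h : IsPentagon f x y z w m b) : IsPentagon f y x w z m (!b) := by
  refine ⟨by have := h.nodup; grind, ?_⟩
  rw [h.eq, Sym2.eq_swap (a := y) (b := x), Sym2.eq_swap (a := w) (b := z)]
  cases b <;> ext e <;> simp <;> tauto

/-- The first edge of the path from `x` to `z` along a pentagon with fifth vertex `m`. -/
def sideFst {V : Type*} (x z m : V) (b : Bool) : Sym2 V := bif b then s(x, m) else s(x, z)

/-- The last edge of the path from `x` to `z` along a pentagon with fifth vertex `m`. -/
def sideLst {V : Type*} (x z m : V) (b : Bool) : Sym2 V := bif b then s(m, z) else s(x, z)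

namespace IsPentagon

variable {V : Type*} [DecidableEq V] {f : Finset (Sym2 V)} {x y z w m : V} {b : Bool}

lemma ne (h : IsPentagon f x y z w m b) : x ≠ y ∧ x ≠ z ∧ x ≠ w ∧ x ≠ m ∧ y ≠ z ∧ y ≠ w ∧
    y ≠ m ∧ z ≠ w ∧ z ≠ m ∧ w ≠ m := by
  have := h.nodup
  simp only [List.nodup_cons, List.mem_cons, List.not_mem_nil, or_false, not_or] at this
  tauto

lemma edges_mem (h : IsPentagon f x y z w m b) : s(x, y) ∈ f ∧ s(z, w) ∈ f ∧
    sideFst x z m b ∈ f ∧ sideLst x z m b ∈ f := by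
  rw [h.eq]
  cases b <;> simp [sideFst, sideLst]

lemma sideFst_ne (h : IsPentagon f x y z w m b) :
    sideFst x z m b ≠ s(x, y) ∧ sideFst x z m b ≠ s(z, w) := by
  obtain ⟨h1, h2, h3, h4, h5, h6, h7, h8, h9, h10⟩ := h.ne
  cases b <;> simp [sideFst, *, Ne.symm h5, Ne.symm h7]

lemma sideLst_ne (h : IsPentagon f x y z w m b) :
    sideLst x z m b ≠ s(x, y) ∧ sideLst x z m b ≠ s(z, w) := by
  obtain ⟨h1, h2, h3, h4, h5, h6, h7, h8, h9, h10⟩ := h.ne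
  cases b <;> simp [sideLst, *, Ne.symm h4, Ne.symm h5, Ne.symm h7, Ne.symm h9, Ne.symm h10]

end IsPentagon

namespace IsFullerene

variable {V : Type*} [Fintype V] [DecidableEq V] {G : SimpleGraph V}
  {faces : Finset (Finset (Sym2 V))}

lemma exists_pentagon_cycle (hF : IsFullerene G faces) {f : Finset (Sym2 V)} (hf : f ∈ faces)
    (h5 : f.card = 5) {x y : V} (hxy : s(x, y) ∈ f) :
    ∃ p q r, [x, y, p, q, r].Nodup ∧ f = {s(x, y), s(y, p), s(p, q), s(q, r), s(r, x)} := by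
  obtain ⟨u, c₀, hc₀, hc₀f⟩ := hF.face_cycle f hf
  have hxy₀ : s(x, y) ∈ c₀.edges := by
    rw [← List.mem_toFinset, hc₀f]; exact hxy
  have hx : x ∈ c₀.support := c₀.fst_mem_support_of_mem_edges hxy₀
  obtain ⟨c, hc, hcf⟩ : ∃ c : G.Walk x x, c.IsCycle ∧ c.edges.toFinset = f :=
    ⟨c₀.rotate x hx, hc₀.rotate hx, by
      rw [← hc₀f]
      exact List.toFinset_eq_of_perm _ _ (c₀.rotate_edges x hx).perm⟩
  have hlen : c.length = 5 := by
    rw [← h5, ← hcf, List.toFinset_card_of_nodup hc.edges_nodup, c.length_edges]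
  have hsup := hc.support_nodup
  match c, hlen with
  | .cons (v := a₁) h₁ (.cons (v := a₂) h₂ (.cons (v := a₃) h₃ (.cons (v := a₄) h₄
      (.cons h₅ .nil)))), _ =>
    simp only [Walk.support_cons, Walk.support_nil, List.tail_cons] at hsup
    simp only [Walk.edges_cons, Walk.edges_nil, List.toFinset_cons, List.toFinset_nil,
      insert_empty_eq] at hcf
    have hxy' := hxy
    rw [← hcf] at hxy'
    simp only [Finset.mem_insert, Finset.mem_singleton, Sym2.eq_iff] at hxy'
    have hy : y = a₁ ∨ y = a₄ := by grind
    rcases hy with rfl | rfl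
    · exact ⟨a₂, a₃, a₄, by grind, hcf.symm⟩
    · refine ⟨a₃, a₂, a₁, by grind, ?_⟩
      rw [← hcf]
      rw [Sym2.eq_swap (a := y) (b := a₃), Sym2.eq_swap (a := a₃) (b := a₂),
        Sym2.eq_swap (a := a₂) (b := a₁), Sym2.eq_swap (a := a₁) (b := x),
        Sym2.eq_swap (a := x) (b := y)]
      ext e
      simp only [Finset.mem_insert, Finset.mem_singleton]
      clear hxy' hsup
      tauto

lemma exists_isPentagon (hF : IsFullerene G faces) {f : Finset (Sym2 V)} (hf : f ∈ faces)
    (h5 : f.card = 5) {x y : V} (hxy : s(x, y) ∈ f) {e : Sym2 V} (he : e ∈ f)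
    (hx : x ∉ e) (hy : y ∉ e) : ∃ z w m b, e = s(z, w) ∧ IsPentagon f x y z w m b := by
  obtain ⟨p, q, r, hnd, hf'⟩ := hF.exists_pentagon_cycle hf h5 hxy
  rw [hf'] at he
  simp only [Finset.mem_insert, Finset.mem_singleton] at he
  rcases he with rfl | rfl | rfl | rfl | rfl
  · simp at hx
  · simp at hy
  · refine ⟨q, p, r, true, Sym2.eq_swap, by grind, ?_⟩
    rw [hf', Sym2.eq_swap (a := q) (b := p), Sym2.eq_swap (a := x) (b := r),
      Sym2.eq_swap (a := r) (b := q)]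
    ext e; simp; tauto
  · refine ⟨r, q, p, false, Sym2.eq_swap, by grind, ?_⟩
    rw [hf', Sym2.eq_swap (a := r) (b := q), Sym2.eq_swap (a := x) (b := r)]
    ext e; simp; tauto
  · simp at hx

end IsFullerene

/-- A ring of seven pentagons `R i` whose shared edges `P i`–`Q i` are labelled so that the `P i`
lie on one boundary of the ring and the `Q i` on the other; `M i` is the remaining vertex of
`R i`, lying on the `P`-side exactly if `X i` holds. -/
structure IsBelt {V : Type*} [DecidableEq V] (faces : Finset (Finset (Sym2 V)))
    (R : ZMod 7 → Finset (Sym2 V)) (P Q M : ZMod 7 → V) (X : ZMod 7 → Bool) : Prop where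
  mem : ∀ i, R i ∈ faces
  card : ∀ i, (R i).card = 5
  inter : ∀ i, R i ∩ R (i + 1) = {s(P i, Q i)}
  disj : ∀ i j, j ≠ i → j ≠ i + 1 → j ≠ i - 1 → Disjoint (faceVerts (R i)) (faceVerts (R j))
  pent : ∀ i, IsPentagon (R i) (P (i - 1)) (Q (i - 1)) (P i) (Q i) (M i) (X i)

namespace IsBelt

variable {V : Type*} [DecidableEq V] {faces : Finset (Finset (Sym2 V))}
  {R : ZMod 7 → Finset (Sym2 V)} {P Q M : ZMod 7 → V} {X : ZMod 7 → Bool}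

lemma swap (h : IsBelt faces R P Q M X) : IsBelt faces R Q P M (fun i => !X i) where
  mem := h.mem
  card := h.card
  inter i := by rw [h.inter, Sym2.eq_swap]
  disj := h.disj
  pent i := (h.pent i).swap

lemma rotate (h : IsBelt faces R P Q M X) (c : ZMod 7) :
    IsBelt faces (fun i => R (i + c)) (fun i => P (i + c)) (fun i => Q (i + c))
      (fun i => M (i + c)) (fun i => X (i + c)) where
  mem i := h.mem _
  card i := h.card _
  inter i := by
    have := h.inter (i + c)
    rwa [add_right_comm] at this
  disj i j h₁ h₂ h₃ := h.disj _ _ (by simpa using h₁)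
    (by rw [add_right_comm]; simpa using h₂) (by rw [add_sub_right_comm]; simpa using h₃)
  pent i := by
    have := h.pent (i + c)
    rwa [add_sub_right_comm] at this

end IsBelt

namespace IsFullerene

variable {V : Type*} [Fintype V] [DecidableEq V] {G : SimpleGraph V}
  {faces : Finset (Finset (Sym2 V))}

/-- The sides of a ring of seven pentagons can be labelled consistently. -/
theorem exists_isBelt (hF : IsFullerene G faces) {R : ZMod 7 → Finset (Sym2 V)}
    (hR : IsPentagonalRing faces 7 R) : ∃ P Q M X, IsBelt faces R P Q M X := by
  classical
  obtain ⟨-, hinj, hmem, hinter, hdisj, hmatch⟩ := hR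
  choose e he using hinter
  have heR : ∀ i, e i ∈ R i ∩ R (i + 1) := fun i => by rw [he]; exact Finset.mem_singleton_self _
  have hel : ∀ i, e i ∈ R i := fun i => (Finset.mem_inter.mp (heR i)).1
  have her : ∀ i, e i ∈ R (i + 1) := fun i => (Finset.mem_inter.mp (heR i)).2
  have hsucc : ∀ i : ZMod 7, i ≠ i + 1 := by decide
  have hpred : ∀ i : ZMod 7, i - 1 ≠ i := by decide
  have hfaces : ∀ f ∈ faces, ∀ i, e i ∈ f → f = R i ∨ f = R (i + 1) := fun f hf i hi =>
    hF.eq_or_eq_of_mem (hmem i).1 (hmem (i + 1)).1 hf (hel i) (her i) hi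
      (fun h => hsucc i (hinj h))
  have heinj : ∀ i j, e i = e j → i = j := by
    intro i j hij
    by_contra hne
    exact hmatch i j hne _ (heR i) _ (heR j) (e i).out.1 (e i).out_fst_mem
      (hij ▸ (e i).out_fst_mem)
  let c : Sym2 V → ZMod 2 := fun x => if ∃ i, x = e i then 1 else 0
  have hc1 : ∀ i, c (e i) = 1 := fun i => if_pos ⟨i, rfl⟩
  have hidx : ∀ i j, e j ∈ R i → j = i ∨ j = i - 1 := by
    intro i j hj
    rcases hfaces _ (hmem i).1 j hj with h | h
    · exact Or.inl (hinj h).symm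
    · exact Or.inr (by rw [hinj h]; ring)
  have hc : ∀ f ∈ faces, ∑ x ∈ f, c x = 0 := by
    intro f hf
    simp only [c]
    rw [← Finset.sum_filter, Finset.sum_const]
    by_cases hfR : ∃ i, f = R i
    · obtain ⟨i, rfl⟩ := hfR
      have : (R i).filter (fun x => ∃ j, x = e j) = {e i, e (i - 1)} := by
        ext x
        simp only [Finset.mem_filter, Finset.mem_insert, Finset.mem_singleton]
        constructor
        · rintro ⟨hx, j, rfl⟩
          rcases hidx i j hx with rfl | rfl <;> simp
        · rintro (rfl | rfl)
          · exact ⟨hel i, i, rfl⟩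
          · exact ⟨by have := her (i - 1); rwa [sub_add_cancel] at this, _, rfl⟩
      rw [this, Finset.card_pair]
      · decide
      · intro h
        exact hpred i (heinj _ _ h).symm
    · have : f.filter (fun x => ∃ j, x = e j) = ∅ := by
        refine Finset.filter_eq_empty_iff.mpr ?_
        rintro x hx ⟨j, rfl⟩
        rcases hfaces f hf j hx with h | h
        · exact hfR ⟨_, h⟩
        · exact hfR ⟨_, h⟩
      simp [this]
  obtain ⟨t, ht⟩ := hF.exists_potential c hc
  have hends : ∀ i, ∃ p q, e i = s(p, q) ∧ t p = 0 ∧ t q = 1 := by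
    intro i
    obtain ⟨a, b, hab⟩ : ∃ a b, e i = s(a, b) := ⟨_, _, (Quot.out_eq (e i)).symm⟩
    have hadj : G.Adj a b := by
      have := hF.mem_edgeSet (hmem i).1 (hel i)
      rwa [hab] at this
    have h1 := ht a b hadj
    rw [← hab, hc1] at h1
    have key : ∀ u v : ZMod 2, 1 = u + v → (u = 0 ∧ v = 1) ∨ (v = 0 ∧ u = 1) := by decide
    rcases key _ _ h1 with h | h
    · exact ⟨a, b, hab, h⟩
    · exact ⟨b, a, hab.trans Sym2.eq_swap, h⟩
  choose P Q hPQ htP htQ using hends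
  have hpent : ∀ i, ∃ m b, IsPentagon (R i) (P (i - 1)) (Q (i - 1)) (P i) (Q i) m b := by
    intro i
    have hprev : s(P (i - 1), Q (i - 1)) ∈ R i := by
      have := her (i - 1)
      rwa [sub_add_cancel, hPQ] at this
    have hm := hmatch (i - 1) i (hpred i) _ (heR _) _ (heR _)
    rw [hPQ (i - 1)] at hm
    obtain ⟨z, w, m, b, hzw, hp⟩ := hF.exists_isPentagon (hmem i).1 (hmem i).2 hprev (hel i)
      (hm _ (by simp)) (hm _ (by simp))
    have hflat : ∀ x ∈ R i, x ≠ s(P (i - 1), Q (i - 1)) → x ≠ s(z, w) →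
        ∀ u v, x = s(u, v) → t u = t v := by
      rintro _ huv h₁ h₂ u v rfl
      rw [← CharTwo.add_eq_zero, ← ht u v (hF.mem_edgeSet (hmem i).1 huv)]
      refine if_neg ?_
      rintro ⟨j, hj⟩
      rw [hj] at huv
      rcases hidx i j huv with rfl | rfl
      · exact h₂ (hj.trans hzw)
      · exact h₁ (hj.trans (hPQ _))
    have htz : t z = 0 := by
      rw [← htP (i - 1)]
      have h1 := hflat _ hp.edges_mem.2.2.1 hp.sideFst_ne.1 hp.sideFst_ne.2
      have h2 := hflat _ hp.edges_mem.2.2.2 hp.sideLst_ne.1 hp.sideLst_ne.2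
      cases b
      · exact (h1 _ _ rfl).symm
      · exact ((h1 _ _ rfl).trans (h2 _ _ rfl)).symm
    rw [hPQ i, Sym2.eq_iff] at hzw
    rcases hzw with ⟨rfl, rfl⟩ | ⟨-, rfl⟩
    · exact ⟨m, b, hp⟩
    · rw [htQ] at htz
      exact absurd htz (by decide)
  choose M X hMX using hpent
  exact ⟨P, Q, M, X, fun i => (hmem i).1, fun i => (hmem i).2, fun i => by rw [he, hPQ], hdisj, hMX⟩

end IsFullerene

namespace IsBelt

variable {V : Type*} [DecidableEq V] {faces : Finset (Finset (Sym2 V))}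
  {R : ZMod 7 → Finset (Sym2 V)} {P Q M : ZMod 7 → V} {X : ZMod 7 → Bool}

lemma shared_mem (h : IsBelt faces R P Q M X) (i : ZMod 7) : s(P i, Q i) ∈ R i :=
  (h.pent i).edges_mem.2.1

lemma shared_mem_succ (h : IsBelt faces R P Q M X) (i : ZMod 7) : s(P i, Q i) ∈ R (i + 1) := by
  have := (h.pent (i + 1)).edges_mem.1
  rwa [add_sub_cancel_right] at this

/-- An edge common to two pentagons of a belt is one of the two shared edges of the first. -/
lemma eq_shared (h : IsBelt faces R P Q M X) {i j : ZMod 7} {k : Sym2 V} (hi : k ∈ R i)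
    (hj : k ∈ R j) (hij : j ≠ i) : k = s(P i, Q i) ∨ k = s(P (i - 1), Q (i - 1)) := by
  by_cases h₁ : j = i + 1
  · subst h₁
    left
    have := Finset.mem_inter.mpr ⟨hi, hj⟩
    rwa [h.inter, Finset.mem_singleton] at this
  by_cases h₂ : j = i - 1
  · subst h₂
    right
    have hint := h.inter (i - 1)
    rw [sub_add_cancel] at hint
    have := Finset.mem_inter.mpr ⟨hj, hi⟩
    rwa [hint, Finset.mem_singleton] at this
  · exact absurd ⟨k, hj, k.out_fst_mem⟩
      (Set.disjoint_left.mp (h.disj i j hij h₁ h₂) ⟨k, hi, k.out_fst_mem⟩)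

end IsBelt

/-- A belt together with the faces along its `P`-side: `F i` is the third face at `P i`, the
edges `l i` and `r i` are the first and last edge of `R i` on the `P`-side, and for `X i` the
edge `g i` is the third edge at `M i`. -/
structure IsFrame {V : Type*} [DecidableEq V] (faces : Finset (Finset (Sym2 V)))
    (R : ZMod 7 → Finset (Sym2 V)) (P Q M : ZMod 7 → V) (X : ZMod 7 → Bool)
    (l r g : ZMod 7 → Sym2 V) (F : ZMod 7 → Finset (Sym2 V)) : Prop
    extends IsBelt faces R P Q M X where
  l_eq : ∀ i, l i = sideFst (P (i - 1)) (P i) (M i) (X i)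
  r_eq : ∀ i, r i = sideLst (P (i - 1)) (P i) (M i) (X i)
  F_mem : ∀ i, F i ∈ faces
  r_mem_F : ∀ i, r i ∈ F i
  l_mem_F : ∀ i, l (i + 1) ∈ F i
  F_ne_R : ∀ i j, F i ≠ R j
  M_mem_g : ∀ i, X i = true → M i ∈ g i
  g_mem_F : ∀ i, X i = true → g i ∈ F i
  g_mem_F_pred : ∀ i, X i = true → g i ∈ F (i - 1)
  F_ne : ∀ i, X i = true → F (i - 1) ≠ F i
  F_eq : ∀ i, X i = false → F (i - 1) = F i

namespace IsFullerene

variable {V : Type*} [Fintype V] [DecidableEq V] {G : SimpleGraph V}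
  {faces : Finset (Finset (Sym2 V))}
  {R : ZMod 7 → Finset (Sym2 V)} {P Q M : ZMod 7 → V} {X : ZMod 7 → Bool}

theorem exists_isFrame (hF : IsFullerene G faces) (h : IsBelt faces R P Q M X) :
    ∃ l r g F, IsFrame faces R P Q M X l r g F := by
  obtain ⟨l, hl⟩ : ∃ l : ZMod 7 → Sym2 V,
      ∀ i, l i = sideFst (P (i - 1)) (P i) (M i) (X i) := ⟨_, fun _ => rfl⟩
  obtain ⟨r, hr⟩ : ∃ r : ZMod 7 → Sym2 V,
      ∀ i, r i = sideLst (P (i - 1)) (P i) (M i) (X i) := ⟨_, fun _ => rfl⟩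
  have hlR : ∀ i, l i ∈ R i := fun i => hl i ▸ (h.pent i).edges_mem.2.2.1
  have hrR : ∀ i, r i ∈ R i := fun i => hr i ▸ (h.pent i).edges_mem.2.2.2
  have hlu : ∀ i j, l i ∈ R j → j = i := by
    intro i j hj
    by_contra hne
    rcases h.eq_shared (hlR i) hj hne with h' | h' <;> rw [hl] at h'
    · exact (h.pent i).sideFst_ne.2 h'
    · exact (h.pent i).sideFst_ne.1 h'
  have hru : ∀ i j, r i ∈ R j → j = i := by
    intro i j hj
    by_contra hne
    rcases h.eq_shared (hrR i) hj hne with h' | h' <;> rw [hr] at h'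
    · exact (h.pent i).sideLst_ne.2 h'
    · exact (h.pent i).sideLst_ne.1 h'
  have hPr : ∀ i, P i ∈ r i := by
    intro i
    rw [hr]
    cases X i <;> simp [sideLst]
  have hPl : ∀ i, P i ∈ l (i + 1) := by
    intro i
    rw [hl, add_sub_cancel_right]
    cases X (i + 1) <;> simp [sideFst]
  have hsucc : ∀ i : ZMod 7, i ≠ i + 1 := by decide
  have hrl : ∀ i, r i ≠ l (i + 1) := fun i h' =>
    hsucc i (hlu _ _ (h' ▸ hrR i))
  have hEl : ∀ i, l i ∈ G.edgeSet := fun i => hF.mem_edgeSet (h.mem i) (hlR i)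
  have hEr : ∀ i, r i ∈ G.edgeSet := fun i => hF.mem_edgeSet (h.mem i) (hrR i)
  choose F hFm hrF hlF using fun i =>
    hF.exists_corner (hEr i) (hEl (i + 1)) (hPr i) (hPl i) (hrl i)
  have hFR : ∀ i j, F i ≠ R j := by
    intro i j hij
    have h₁ := hru i j (hij ▸ hrF i)
    have h₂ := hlu (i + 1) j (hij ▸ hlF i)
    exact hsucc i (h₁.symm.trans h₂)
  have hlF' : ∀ i, l i ∈ F (i - 1) := by
    intro i
    have := hlF (i - 1)
    rwa [sub_add_cancel] at this
  have hMl : ∀ i, X i = true → M i ∈ l i := by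
    intro i hX
    rw [hl, hX]; simp [sideFst]
  have hMr : ∀ i, X i = true → M i ∈ r i := by
    intro i hX
    rw [hr, hX]; simp [sideLst]
  have hlr : ∀ i, X i = true → l i ≠ r i := by
    intro i hX heq
    rw [hl, hr, hX] at heq
    obtain ⟨h1, h2, h3, h4, h5, h6, h7, h8, h9, h10⟩ := (h.pent i).ne
    simp [sideFst, sideLst, h2, h4] at heq
  have hcorner : ∀ i, X i = true → ∀ f ∈ faces, l i ∈ f → r i ∈ f → f = R i :=
    fun i hX f hf h₁ h₂ =>
      hF.corner_unique (hMl i hX) (hMr i hX) (hlr i hX) hf (h.mem i) h₁ h₂ (hlR i) (hrR i)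
  have hg : ∀ i, ∃ g, X i = true → M i ∈ g ∧ g ∈ F i ∧ g ∈ F (i - 1) := by
    intro i
    by_cases hX : X i = true
    · obtain ⟨g, -, hMg, hgl, hgr, hall⟩ :=
        hF.exists_third_edge (hEl i) (hEr i) (hMl i hX) (hMr i hX) (hlr i hX)
      refine ⟨g, fun _ => ⟨hMg, ?_, ?_⟩⟩
      · obtain ⟨x, hx, hxr, hMx, -⟩ := hF.exists_other_edge (hFm i) (hrF i) (hMr i hX)
        rcases hall x (hF.mem_edgeSet (hFm i) hx) hMx with rfl | rfl | rfl
        · exact absurd (hcorner i hX _ (hFm i) hx (hrF i)) (hFR i i)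
        · exact absurd rfl hxr
        · exact hx
      · obtain ⟨x, hx, hxl, hMx, -⟩ := hF.exists_other_edge (hFm (i - 1)) (hlF' i) (hMl i hX)
        rcases hall x (hF.mem_edgeSet (hFm (i - 1)) hx) hMx with rfl | rfl | rfl
        · exact absurd rfl hxl
        · exact absurd (hcorner i hX _ (hFm (i - 1)) (hlF' i) hx) (hFR (i - 1) i)
        · exact hx
    · exact ⟨l i, fun h' => absurd h' hX⟩
  choose g hg using hg
  refine ⟨l, r, g, F, h, hl, hr, hFm, hrF, hlF, hFR, fun i hX => (hg i hX).1,
    fun i hX => (hg i hX).2.1, fun i hX => (hg i hX).2.2, fun i hX heq => ?_, fun i hX => ?_⟩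
  · exact hFR i i (hcorner i hX _ (hFm i) (heq ▸ hlF' i) (hrF i))
  · have hlr' : l i = r i := by rw [hl, hr, hX]; rfl
    rcases hF.eq_or_eq_of_mem (hFm (i - 1)) (h.mem i) (hFm i) (hlF' i) (hlR i)
      (hlr' ▸ hrF i) (hFR _ _) with h' | h'
    · exact h'.symm
    · exact absurd h' (hFR _ _)

end IsFullerene

namespace IsFrame

variable {V : Type*} [DecidableEq V] {faces : Finset (Finset (Sym2 V))}
  {R F : ZMod 7 → Finset (Sym2 V)} {P Q M : ZMod 7 → V} {X : ZMod 7 → Bool}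
  {l r g : ZMod 7 → Sym2 V}

lemma l_mem_R (h : IsFrame faces R P Q M X l r g F) (i : ZMod 7) : l i ∈ R i :=
  h.l_eq i ▸ (h.pent i).edges_mem.2.2.1

lemma r_mem_R (h : IsFrame faces R P Q M X l r g F) (i : ZMod 7) : r i ∈ R i :=
  h.r_eq i ▸ (h.pent i).edges_mem.2.2.2

lemma l_mem_R_iff (h : IsFrame faces R P Q M X l r g F) {i j : ZMod 7} : l i ∈ R j ↔ j = i := by
  refine ⟨fun hj => ?_, fun hj => hj ▸ h.l_mem_R i⟩
  by_contra hne
  rcases h.eq_shared (h.l_mem_R i) hj hne with h' | h' <;> rw [h.l_eq] at h'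
  · exact (h.pent i).sideFst_ne.2 h'
  · exact (h.pent i).sideFst_ne.1 h'

lemma r_mem_R_iff (h : IsFrame faces R P Q M X l r g F) {i j : ZMod 7} : r i ∈ R j ↔ j = i := by
  refine ⟨fun hj => ?_, fun hj => hj ▸ h.r_mem_R i⟩
  by_contra hne
  rcases h.eq_shared (h.r_mem_R i) hj hne with h' | h' <;> rw [h.r_eq] at h'
  · exact (h.pent i).sideLst_ne.2 h'
  · exact (h.pent i).sideLst_ne.1 h'

lemma l_ne_l (h : IsFrame faces R P Q M X l r g F) {i j : ZMod 7} (hij : i ≠ j) : l i ≠ l j :=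
  fun h' => hij (h.l_mem_R_iff.mp (h' ▸ h.l_mem_R i))

lemma r_ne_l (h : IsFrame faces R P Q M X l r g F) {i j : ZMod 7} (hij : i ≠ j) : r i ≠ l j :=
  fun h' => hij (h.l_mem_R_iff.mp (h' ▸ h.r_mem_R i))

lemma r_ne_r (h : IsFrame faces R P Q M X l r g F) {i j : ZMod 7} (hij : i ≠ j) : r i ≠ r j :=
  fun h' => hij (h.r_mem_R_iff.mp (h' ▸ h.r_mem_R i))

lemma P_mem_r (h : IsFrame faces R P Q M X l r g F) (i : ZMod 7) : P i ∈ r i := by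
  rw [h.r_eq]
  cases X i <;> simp [sideLst]

lemma P_mem_l (h : IsFrame faces R P Q M X l r g F) (i : ZMod 7) : P i ∈ l (i + 1) := by
  rw [h.l_eq, add_sub_cancel_right]
  cases X (i + 1) <;> simp [sideFst]

lemma l_of_true (h : IsFrame faces R P Q M X l r g F) {i : ZMod 7} (hX : X i = true) :
    l i = s(P (i - 1), M i) := by
  rw [h.l_eq, hX]; rfl

lemma r_of_true (h : IsFrame faces R P Q M X l r g F) {i : ZMod 7} (hX : X i = true) :
    r i = s(M i, P i) := by
  rw [h.r_eq, hX]; rfl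

lemma l_of_false (h : IsFrame faces R P Q M X l r g F) {i : ZMod 7} (hX : X i = false) :
    l i = s(P (i - 1), P i) := by
  rw [h.l_eq, hX]; rfl

lemma l_ne_r (h : IsFrame faces R P Q M X l r g F) {i : ZMod 7} (hX : X i = true) :
    l i ≠ r i := fun heq => by
  have hne := (h.pent i).ne
  rw [h.l_of_true hX, h.r_of_true hX] at heq
  simp [hne.2.1, hne.2.2.2.1] at heq

lemma M_mem_l (h : IsFrame faces R P Q M X l r g F) {i : ZMod 7} (hX : X i = true) :
    M i ∈ l i := by simp [h.l_of_true hX]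

lemma M_mem_r (h : IsFrame faces R P Q M X l r g F) {i : ZMod 7} (hX : X i = true) :
    M i ∈ r i := by simp [h.r_of_true hX]

lemma g_eq_of_mem (h : IsFrame faces R P Q M X l r g F) {i : ZMod 7} (hi : X i = true) {v : V}
    (hv : v ∈ g i) (hl : v ∉ l i) : g i = s(M i, v) := by
  have hne : M i ≠ v := by
    rintro rfl
    exact hl (h.M_mem_l hi)
  exact (Sym2.mem_and_mem_iff hne).mp ⟨h.M_mem_g i hi, hv⟩

variable [Fintype V] {G : SimpleGraph V}

lemma F_eq_of_g_mem (h : IsFrame faces R P Q M X l r g F) (hF : IsFullerene G faces) {i : ZMod 7}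
    (hX : X i = true) {f : Finset (Sym2 V)} (hf : f ∈ faces) (hg : g i ∈ f) :
    f = F (i - 1) ∨ f = F i :=
  hF.eq_or_eq_of_mem (h.F_mem _) (h.F_mem _) hf (h.g_mem_F_pred i hX) (h.g_mem_F i hX) hg
    (h.F_ne i hX)

lemma g_notMem_R (h : IsFrame faces R P Q M X l r g F) (hF : IsFullerene G faces) {i : ZMod 7}
    (hX : X i = true) (j : ZMod 7) : g i ∉ R j := fun hg => by
  rcases h.F_eq_of_g_mem hF hX (h.mem j) hg with h' | h'
  · exact h.F_ne_R _ _ h'.symm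
  · exact h.F_ne_R _ _ h'.symm

lemma g_ne_l (h : IsFrame faces R P Q M X l r g F) (hF : IsFullerene G faces) {i : ZMod 7}
    (hX : X i = true) (j : ZMod 7) : g i ≠ l j := fun h' =>
  h.g_notMem_R hF hX j (h' ▸ h.l_mem_R j)

lemma g_ne_r (h : IsFrame faces R P Q M X l r g F) (hF : IsFullerene G faces) {i : ZMod 7}
    (hX : X i = true) (j : ZMod 7) : g i ≠ r j := fun h' =>
  h.g_notMem_R hF hX j (h' ▸ h.r_mem_R j)

/-- All edges at a vertex `P i` belong to the belt. -/
lemma exists_mem_R_of_P_mem (h : IsFrame faces R P Q M X l r g F) (hF : IsFullerene G faces)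
    {i : ZMod 7} {x : Sym2 V} (hx : x ∈ G.edgeSet) (hP : P i ∈ x) : ∃ j, x ∈ R j := by
  have hsucc : ∀ i : ZMod 7, i ≠ i + 1 := by decide
  obtain ⟨y, -, -, -, -, hall⟩ := hF.exists_third_edge (hF.mem_edgeSet (h.mem _) (h.r_mem_R i))
    (hF.mem_edgeSet (h.mem _) (h.l_mem_R (i + 1))) (h.P_mem_r i) (h.P_mem_l i)
    (h.r_ne_l (hsucc i))
  rcases hall _ (hF.mem_edgeSet (h.mem _) (h.shared_mem i)) (by simp) with h' | h' | h'
  · exact absurd (h.r_mem_R_iff.mp (h' ▸ h.shared_mem_succ i)) (hsucc i).symm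
  · exact absurd (h.l_mem_R_iff.mp (h' ▸ h.shared_mem i)) (hsucc i)
  · rcases hall x hx hP with rfl | rfl | rfl
    · exact ⟨_, h.r_mem_R i⟩
    · exact ⟨_, h.l_mem_R _⟩
    · exact ⟨_, h' ▸ h.shared_mem i⟩

lemma P_notMem_g (h : IsFrame faces R P Q M X l r g F) (hF : IsFullerene G faces) {i : ZMod 7}
    (hX : X i = true) (j : ZMod 7) : P j ∉ g i := fun hP => by
  obtain ⟨k, hk⟩ := h.exists_mem_R_of_P_mem hF (hF.mem_edgeSet (h.F_mem i) (h.g_mem_F i hX)) hP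
  exact h.g_notMem_R hF hX k hk

/-- The spoke `g i` is the only edge at `M i` outside the belt. -/
lemma eq_g_of_M_mem (h : IsFrame faces R P Q M X l r g F) (hF : IsFullerene G faces) {i : ZMod 7}
    (hX : X i = true) {x : Sym2 V} (hx : x ∈ G.edgeSet) (hM : M i ∈ x) (hxR : x ∉ R i) :
    x = g i := by
  obtain ⟨y, -, -, -, -, hall⟩ := hF.exists_third_edge (hF.mem_edgeSet (h.mem _) (h.l_mem_R i))
    (hF.mem_edgeSet (h.mem _) (h.r_mem_R i)) (h.M_mem_l hX) (h.M_mem_r hX) (h.l_ne_r hX)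
  rcases hall x hx hM with rfl | rfl | rfl
  · exact absurd (h.l_mem_R i) hxR
  · exact absurd (h.r_mem_R i) hxR
  · rcases hall (g i) (hF.mem_edgeSet (h.F_mem i) (h.g_mem_F i hX)) (h.M_mem_g i hX) with
      h' | h' | h'
    · exact absurd h' (h.g_ne_l hF hX i)
    · exact absurd h' (h.g_ne_r hF hX i)
    · exact h'.symm

lemma M_mem_R (h : IsFrame faces R P Q M X l r g F) (hF : IsFullerene G faces) {i j : ZMod 7}
    (hX : X i = true) (hM : M i ∈ faceVerts (R j)) : j = i := by
  by_contra hne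
  obtain ⟨k, hki, hkj, hMk⟩ := hF.exists_common_edge (h.mem i) (h.mem j)
    ⟨_, h.l_mem_R i, h.M_mem_l hX⟩ hM
  obtain ⟨h1, h2, h3, h4, h5, h6, h7, h8, h9, h10⟩ := (h.pent i).ne
  rcases h.eq_shared hki hkj hne with rfl | rfl
  · simp [h9.symm, h10.symm] at hMk
  · simp [h4.symm, h7.symm] at hMk

lemma M_ne_M (h : IsFrame faces R P Q M X l r g F) (hF : IsFullerene G faces) {i j : ZMod 7}
    (hX : X i = true) (hXj : X j = true) (hij : i ≠ j) : M i ≠ M j := fun h' =>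
  hij (h.M_mem_R hF hXj ⟨_, h.l_mem_R i, h' ▸ h.M_mem_l hX⟩)

end IsFrame

namespace IsFullerene

variable {V : Type*} [Fintype V] [DecidableEq V] {G : SimpleGraph V}
  {faces : Finset (Finset (Sym2 V))} {f : Finset (Sym2 V)}

lemma length_le_six (hF : IsFullerene G faces) (hf : f ∈ faces) {L : List (Sym2 V)}
    (hL : L.Nodup) (hmem : ∀ x ∈ L, x ∈ f) : L.length ≤ 6 := by
  rw [← List.toFinset_card_of_nodup hL]
  have hle : L.toFinset.card ≤ f.card :=
    Finset.card_le_card fun x hx => hmem x (List.mem_toFinset.mp hx)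
  rcases hF.face_size f hf with h | h <;> omega

lemma mem_of_length_eq_six (hF : IsFullerene G faces) (hf : f ∈ faces) {L : List (Sym2 V)}
    (hL : L.Nodup) (hmem : ∀ x ∈ L, x ∈ f) (hlen : L.length = 6) {x : Sym2 V} (hx : x ∈ f) :
    x ∈ L := by
  by_contra hxL
  have := hF.length_le_six hf (List.nodup_cons.mpr ⟨hxL, hL⟩)
    (by simpa using ⟨hx, hmem⟩)
  simp [hlen] at this

lemma not_quadrilateral (hF : IsFullerene G faces) (hf : f ∈ faces) {a b c d : V}
    (hnd : [s(a, b), s(b, c), s(c, d), s(d, a)].Nodup) (h₁ : s(a, b) ∈ f) (h₂ : s(b, c) ∈ f)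
    (h₃ : s(c, d) ∈ f) (h₄ : s(d, a) ∈ f) : False := by
  have hcard : [s(a, b), s(b, c), s(c, d), s(d, a)].toFinset.card = 4 :=
    List.toFinset_card_of_nodup hnd
  have hsize := hF.face_size f hf
  have := hF.eq_of_closed (H := [s(a, b), s(b, c), s(c, d), s(d, a)].toFinset) hf
    (by intro x; simp; rintro (rfl | rfl | rfl | rfl) <;> assumption)
    (by
      simp only [List.nodup_cons, List.mem_cons, List.not_mem_nil, or_false, not_or] at hnd
      intro x hx v hv
      simp only [List.mem_toFinset, List.mem_cons, List.not_mem_nil, or_false] at hx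
      rcases hx with rfl | rfl | rfl | rfl <;> rcases Sym2.mem_iff.mp hv with rfl | rfl
      · exact ⟨s(d, v), by simp, by grind, by simp⟩
      · exact ⟨s(v, c), by simp, by grind, by simp⟩
      · exact ⟨s(a, v), by simp, by grind, by simp⟩
      · exact ⟨s(v, d), by simp, by grind, by simp⟩
      · exact ⟨s(b, v), by simp, by grind, by simp⟩
      · exact ⟨s(v, a), by simp, by grind, by simp⟩
      · exact ⟨s(c, v), by simp, by grind, by simp⟩
      · exact ⟨s(v, b), by simp, by grind, by simp⟩) (by omega)
  rw [this] at hsize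
  omega

lemma eq_of_pentagon (hF : IsFullerene G faces) (hf : f ∈ faces) {a b c d e : V}
    (hnd : [s(a, b), s(b, c), s(c, d), s(d, e), s(e, a)].Nodup) (h₁ : s(a, b) ∈ f)
    (h₂ : s(b, c) ∈ f) (h₃ : s(c, d) ∈ f) (h₄ : s(d, e) ∈ f) (h₅ : s(e, a) ∈ f) :
    f = [s(a, b), s(b, c), s(c, d), s(d, e), s(e, a)].toFinset := by
  have hcard : [s(a, b), s(b, c), s(c, d), s(d, e), s(e, a)].toFinset.card = 5 :=
    List.toFinset_card_of_nodup hnd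
  have hsize := hF.face_size f hf
  refine hF.eq_of_closed hf
    (by intro x; simp; rintro (rfl | rfl | rfl | rfl | rfl) <;> assumption) ?_ (by omega)
  simp only [List.nodup_cons, List.mem_cons, List.not_mem_nil, or_false, not_or] at hnd
  intro x hx v hv
  simp only [List.mem_toFinset, List.mem_cons, List.not_mem_nil, or_false] at hx
  rcases hx with rfl | rfl | rfl | rfl | rfl <;> rcases Sym2.mem_iff.mp hv with rfl | rfl
  · exact ⟨s(e, v), by simp, by grind, by simp⟩
  · exact ⟨s(v, c), by simp, by grind, by simp⟩
  · exact ⟨s(a, v), by simp, by grind, by simp⟩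
  · exact ⟨s(v, d), by simp, by grind, by simp⟩
  · exact ⟨s(b, v), by simp, by grind, by simp⟩
  · exact ⟨s(v, e), by simp, by grind, by simp⟩
  · exact ⟨s(c, v), by simp, by grind, by simp⟩
  · exact ⟨s(v, a), by simp, by grind, by simp⟩
  · exact ⟨s(d, v), by simp, by grind, by simp⟩
  · exact ⟨s(v, b), by simp, by grind, by simp⟩

end IsFullerene

/-- In a ring of six pentagons the shared edges form a matching automatically. -/
lemma isPentagonalRing_six {V : Type*} [DecidableEq V] {faces : Finset (Finset (Sym2 V))}
    {A : ZMod 6 → Finset (Sym2 V)} (hmem : ∀ i, A i ∈ faces) (hcard : ∀ i, (A i).card = 5)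
    (hinter : ∀ i, ∃ e, A i ∩ A (i + 1) = {e})
    (htwo : ∀ i, Disjoint (faceVerts (A i)) (faceVerts (A (i + 2))))
    (hthree : ∀ i, Disjoint (faceVerts (A i)) (faceVerts (A (i + 3)))) :
    IsPentagonalRing faces 6 A := by
  have hdisj : ∀ i j : ZMod 6, j ≠ i → j ≠ i + 1 → j ≠ i - 1 →
      Disjoint (faceVerts (A i)) (faceVerts (A j)) := by
    intro i j h₁ h₂ h₃
    have arith : ∀ i j : ZMod 6, j ≠ i → j ≠ i + 1 → j ≠ i - 1 →
        j = i + 2 ∨ j = i + 3 ∨ i = j + 2 := by decide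
    rcases arith i j h₁ h₂ h₃ with rfl | rfl | rfl
    · exact htwo i
    · exact hthree i
    · exact (htwo j).symm
  refine ⟨by norm_num, ?_, fun i => ⟨hmem i, hcard i⟩, hinter, hdisj, ?_⟩
  · intro i j hij
    by_contra hne
    have arith : ∀ i j : ZMod 6, i ≠ j →
        j = i + 1 ∨ i = j + 1 ∨ j ≠ i ∧ j ≠ i + 1 ∧ j ≠ i - 1 := by decide
    rcases arith i j hne with rfl | rfl | ⟨h₁, h₂, h₃⟩
    · obtain ⟨e, he⟩ := hinter i
      rw [← hij, Finset.inter_self] at he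
      simpa [he] using hcard i
    · obtain ⟨e, he⟩ := hinter j
      rw [hij, Finset.inter_self] at he
      simpa [he] using hcard j
    · obtain ⟨e, he⟩ := Finset.card_pos.mp (by rw [hcard i]; norm_num : 0 < (A i).card)
      exact Set.disjoint_left.mp (hdisj i j h₁ h₂ h₃) ⟨e, he, e.out_fst_mem⟩
        ⟨e, hij ▸ he, e.out_fst_mem⟩
  · intro i j hij e he e' he' v hv hve
    rw [Finset.mem_inter] at he he'
    have arith : ∀ i j : ZMod 6, i ≠ j → i = j + 1 ∨ j ≠ i ∧ j ≠ i + 1 ∧ j ≠ i - 1 ∨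
        j + 1 ≠ i ∧ j + 1 ≠ i + 1 ∧ j + 1 ≠ i - 1 := by decide
    rcases arith i j hij with rfl | ⟨h₁, h₂, h₃⟩ | ⟨h₁, h₂, h₃⟩
    · have := htwo j
      rw [show j + 2 = j + 1 + 1 by ring] at this
      exact Set.disjoint_left.mp this ⟨e', he'.1, hve⟩ ⟨e, he.2, hv⟩
    · exact Set.disjoint_left.mp (hdisj _ _ h₁ h₂ h₃) ⟨e, he.1, hv⟩ ⟨e', he'.1, hve⟩
    · exact Set.disjoint_left.mp (hdisj _ _ h₁ h₂ h₃) ⟨e, he.1, hv⟩ ⟨e', he'.2, hve⟩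

/-- Up to rotation and exchange of the two sides, either four consecutive fifth vertices of a
seven-ring lie on the same side, or the pattern is one of five. -/
lemma exists_side_pattern (X : ZMod 7 → Bool) : ∃ (b : Bool) (c : ZMod 7),
    (∀ i ∈ ({1, 2, 3, 4} : Finset (ZMod 7)), (X (i + c) ^^ b) = false) ∨
    ∃ s ∈ ({{0, 3}, {0, 4, 6}, {0, 4, 5}, {0, 3, 6}, {0, 2, 4}} : Finset (Finset (ZMod 7))),
      ∀ i, (X (i + c) ^^ b) = decide (i ∈ s) := by
  revert X
  decide +kernel

namespace IsFrame

variable {V : Type*} [Fintype V] [DecidableEq V] {G : SimpleGraph V}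
  {faces : Finset (Finset (Sym2 V))} {R F : ZMod 7 → Finset (Sym2 V)} {P Q M : ZMod 7 → V}
  {X : ZMod 7 → Bool} {l r g : ZMod 7 → Sym2 V}

lemma g_ne_g (h : IsFrame faces R P Q M X l r g F) (hF : IsFullerene G faces) {i j : ZMod 7}
    (hi : X i = true) (hj : X j = true) (h₁ : F (i - 1) ≠ F (j - 1)) (h₂ : F (i - 1) ≠ F j) :
    g i ≠ g j := fun heq => by
  rcases h.F_eq_of_g_mem hF hj (h.F_mem _) (heq ▸ h.g_mem_F_pred i hi) with hk | hk
  · exact h₁ hk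
  · exact h₂ hk

/-- A spoke meets the belt only at the fifth vertices of pentagons whose spoke it is. -/
lemma eq_of_mem_g (h : IsFrame faces R P Q M X l r g F) (hF : IsFullerene G faces) {i j : ZMod 7}
    (hi : X i = true) {v : V} (hv : v ∈ g i) (hj : v ∈ l j ∨ v ∈ r j) :
    X j = true ∧ v = M j ∧ g i = g j := by
  have hP : ∀ k, v ≠ P k := fun k h' => h.P_notMem_g hF hi k (h' ▸ hv)
  have hvM : X j = true ∧ v = M j := by
    rw [h.l_eq, h.r_eq] at hj
    cases hX : X j
    · simp [hX, sideFst, sideLst, hP] at hj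
    · simpa [hX, sideFst, sideLst, hP] using hj
  refine ⟨hvM.1, hvM.2, ?_⟩
  exact h.eq_g_of_M_mem hF hvM.1 (hF.mem_edgeSet (h.F_mem i) (h.g_mem_F i hi)) (hvM.2 ▸ hv)
    (h.g_notMem_R hF hi j)

lemma exists_eq_g (h : IsFrame faces R P Q M X l r g F) (hF : IsFullerene G faces) {i : ZMod 7}
    (hi : X i = true) : ∃ v, g i = s(M i, v) ∧ v ≠ M i := by
  obtain ⟨v, hv⟩ := h.M_mem_g i hi
  refine ⟨v, hv, ?_⟩
  rintro rfl
  have := hF.mem_edgeSet (h.F_mem i) (h.g_mem_F i hi)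
  rw [hv, SimpleGraph.mem_edgeSet] at this
  exact this.ne rfl

lemma not_run (h : IsFrame faces R P Q M X l r g F) (hF : IsFullerene G faces)
    (hX : ∀ i ∈ ({1, 2, 3, 4} : Finset (ZMod 7)), X i = false) : False := by
  have e₁ : F 0 = F 1 := h.F_eq 1 (hX 1 (by decide))
  have e₂ : F 0 = F 2 := e₁.trans (h.F_eq 2 (hX 2 (by decide)))
  have e₃ : F 0 = F 3 := e₂.trans (h.F_eq 3 (hX 3 (by decide)))
  have e₄ : F 0 = F 4 := e₃.trans (h.F_eq 4 (hX 4 (by decide)))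
  have hr₀ : r 0 ∈ F 0 := h.r_mem_F 0
  have hl₁ : l 1 ∈ F 0 := h.l_mem_F 0
  have hl₂ : l 2 ∈ F 0 := e₁ ▸ h.l_mem_F 1
  have hl₃ : l 3 ∈ F 0 := e₂ ▸ h.l_mem_F 2
  have hl₄ : l 4 ∈ F 0 := e₃ ▸ h.l_mem_F 3
  have hl₅ : l 5 ∈ F 0 := e₄ ▸ h.l_mem_F 4
  obtain ⟨x, hx, hxl, hxr⟩ : ∃ x ∈ F 0, (∀ i ∈ ({1, 2, 3, 4, 5} : Finset (ZMod 7)), x ≠ l i) ∧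
      x ≠ r 0 := by
    by_cases h₀ : X 0 = true
    · exact ⟨g 0, h.g_mem_F 0 h₀, fun i _ => h.g_ne_l hF h₀ i, h.g_ne_r hF h₀ 0⟩
    · have e₀ : F 6 = F 0 := h.F_eq 0 (by simpa using h₀)
      refine ⟨r 6, e₀ ▸ h.r_mem_F 6, fun i hi => h.r_ne_l ?_, h.r_ne_r (by decide)⟩
      rintro rfl
      exact absurd hi (by decide)
  have := hF.length_le_six (h.F_mem 0) (L := [x, r 0, l 1, l 2, l 3, l 4, l 5])
    (by simp +decide [hxr, hxl, h.r_ne_l, h.l_ne_l])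
    (by simp [hx, hr₀, hl₁, hl₂, hl₃, hl₄, hl₅])
  simp at this

lemma not_gap_four (h : IsFrame faces R P Q M X l r g F) (hF : IsFullerene G faces)
    (hX : ∀ i ∈ ({1, 2, 3} : Finset (ZMod 7)), X i = false) (h₀ : X 0 = true) (h₄ : X 4 = true)
    (hne : F 6 ≠ F 4) : False := by
  have e₁ : F 0 = F 1 := h.F_eq 1 (hX 1 (by decide))
  have e₂ : F 0 = F 2 := e₁.trans (h.F_eq 2 (hX 2 (by decide)))
  have e₃ : F 0 = F 3 := e₂.trans (h.F_eq 3 (hX 3 (by decide)))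
  have hr₀ : r 0 ∈ F 0 := h.r_mem_F 0
  have hl₁ : l 1 ∈ F 0 := h.l_mem_F 0
  have hl₂ : l 2 ∈ F 0 := e₁ ▸ h.l_mem_F 1
  have hl₃ : l 3 ∈ F 0 := e₂ ▸ h.l_mem_F 2
  have hl₄ : l 4 ∈ F 0 := e₃ ▸ h.l_mem_F 3
  have hg₀ : g 0 ∈ F 0 := h.g_mem_F 0 h₀
  have hg₄ : g 4 ∈ F 0 := e₃ ▸ h.g_mem_F_pred 4 h₄
  have hn : F 6 ≠ F 0 := h.F_ne 0 h₀
  have hgg : g 0 ≠ g 4 := h.g_ne_g hF h₀ h₄ (e₃ ▸ hn : F 6 ≠ F 3) hne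
  have := hF.length_le_six (h.F_mem 0) (L := [g 0, g 4, r 0, l 1, l 2, l 3, l 4])
    (by simp +decide [hgg, h.g_ne_l hF, h.g_ne_r hF, h₀, h₄, h.r_ne_l, h.l_ne_l])
    (by simp [hr₀, hl₁, hl₂, hl₃, hl₄, hg₀, hg₄])
  simp at this

/-- The spokes for the pattern `{0, 3, 6}` would bound a quadrilateral. -/
lemma not_pattern_zero_three_six
    (h : IsFrame faces R P Q M (fun i => decide (i ∈ ({0, 3, 6} : Finset (ZMod 7)))) l r g F)
    (hF : IsFullerene G faces) : False := by
  have e₁ : F 0 = F 1 := h.F_eq 1 rfl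
  have e₂ : F 0 = F 2 := e₁.trans (h.F_eq 2 rfl)
  have e₄ : F 3 = F 4 := h.F_eq 4 rfl
  have e₅ : F 3 = F 5 := e₄.trans (h.F_eq 5 rfl)
  have n₀ : F 6 ≠ F 0 := h.F_ne 0 rfl
  have n₃ : F 0 ≠ F 3 := e₂ ▸ h.F_ne 3 rfl
  have n₆ : F 3 ≠ F 6 := e₅ ▸ h.F_ne 6 rfl
  have hg₀ : g 0 ∈ F 0 := h.g_mem_F 0 rfl
  have hg₀' : g 0 ∈ F 6 := h.g_mem_F_pred 0 rfl
  have hg₃ : g 3 ∈ F 3 := h.g_mem_F 3 rfl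
  have hg₃' : g 3 ∈ F 0 := e₂ ▸ h.g_mem_F_pred 3 rfl
  have hg₆ : g 6 ∈ F 6 := h.g_mem_F 6 rfl
  have hg₆' : g 6 ∈ F 3 := e₅ ▸ h.g_mem_F_pred 6 rfl
  have g₀₃ : g 0 ≠ g 3 := h.g_ne_g hF rfl rfl (e₂ ▸ n₀ : F 6 ≠ F 2) n₆.symm
  have g₃₆ : g 3 ≠ g 6 := h.g_ne_g hF rfl rfl (e₂ ▸ e₅ ▸ n₃ : F 2 ≠ F 5) (e₂ ▸ n₀.symm : F 2 ≠ F 6)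
  have g₆₀ : g 6 ≠ g 0 := h.g_ne_g hF rfl rfl (e₅ ▸ n₆ : F 5 ≠ F 6) (e₅ ▸ n₃.symm : F 5 ≠ F 0)
  have hr₀ : r 0 ∈ F 0 := h.r_mem_F 0
  have hl₁ : l 1 ∈ F 0 := h.l_mem_F 0
  have hl₂ : l 2 ∈ F 0 := e₁ ▸ h.l_mem_F 1
  have hl₃ : l 3 ∈ F 0 := e₂ ▸ h.l_mem_F 2
  have hr₃ : r 3 ∈ F 3 := h.r_mem_F 3
  have hl₄ : l 4 ∈ F 3 := h.l_mem_F 3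
  have hl₅ : l 5 ∈ F 3 := e₄ ▸ h.l_mem_F 4
  have hl₆ : l 6 ∈ F 3 := e₅ ▸ h.l_mem_F 5
  obtain ⟨v, hgv, hvM⟩ := h.exists_eq_g hF (i := 3) rfl
  have hv : v ∈ g 3 := by simp [hgv]
  have hfree : ∀ j, v ∉ l j ∧ v ∉ r j := by
    intro j
    by_contra hj
    obtain ⟨hXj, hvj, hgj⟩ := h.eq_of_mem_g hF (i := 3) (j := j) rfl hv (by tauto)
    have hj : j = 0 ∨ j = 3 ∨ j = 6 := by simpa using hXj
    rcases hj with rfl | rfl | rfl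
    · exact g₀₃ hgj.symm
    · exact hvM hvj
    · exact g₃₆ hgj
  obtain ⟨x, hx, hx₃, hvx, -⟩ := hF.exists_other_edge (h.F_mem 0) hg₃' hv
  obtain ⟨y, hy, hy₃, hvy, -⟩ := hF.exists_other_edge (h.F_mem 3) hg₃ hv
  have hxL := hF.mem_of_length_eq_six (h.F_mem 0) (L := [g 0, g 3, r 0, l 1, l 2, l 3])
    (by simp +decide [g₀₃, h.g_ne_l hF, h.g_ne_r hF, h.r_ne_l, h.l_ne_l])
    (by simp [hr₀, hl₁, hl₂, hl₃, hg₀, hg₃']) rfl hx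
  have hyL := hF.mem_of_length_eq_six (h.F_mem 3) (L := [g 3, g 6, r 3, l 4, l 5, l 6])
    (by simp +decide [g₃₆, h.g_ne_l hF, h.g_ne_r hF, h.r_ne_l, h.l_ne_l])
    (by simp [hr₃, hl₄, hl₅, hl₆, hg₃, hg₆']) rfl hy
  have hv₀ : v ∈ g 0 := by
    simp only [List.mem_cons, List.not_mem_nil, or_false] at hxL
    rcases hxL with rfl | rfl | rfl | rfl | rfl | rfl
    · exact hvx
    · exact absurd rfl hx₃
    all_goals simp [hfree] at hvx
  have hv₆ : v ∈ g 6 := by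
    simp only [List.mem_cons, List.not_mem_nil, or_false] at hyL
    rcases hyL with rfl | rfl | rfl | rfl | rfl | rfl
    · exact absurd rfl hy₃
    · exact hvy
    all_goals simp [hfree] at hvy
  have hr₆ : r 6 ∈ F 6 := h.r_mem_F 6
  have hl₀ : l 0 ∈ F 6 := h.l_mem_F 6
  have E₁ : r 6 = s(M 6, P 6) := h.r_of_true rfl
  have E₂ : l 0 = s(P 6, M 0) := h.l_of_true rfl
  have E₃ : g 0 = s(M 0, v) := h.g_eq_of_mem rfl hv₀ (hfree 0).1
  have E₄ : g 6 = s(v, M 6) := (h.g_eq_of_mem rfl hv₆ (hfree 6).1).trans Sym2.eq_swap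
  refine hF.not_quadrilateral (h.F_mem 6) (a := M 6) (b := P 6) (c := M 0) (d := v) ?_
    (E₁ ▸ hr₆) (E₂ ▸ hl₀) (E₃ ▸ hg₀') (E₄ ▸ hg₆)
  rw [← E₁, ← E₂, ← E₃, ← E₄]
  simp +decide [g₆₀.symm, (h.g_ne_l hF _ _).symm, (h.g_ne_r hF _ _).symm, h.r_ne_l]

end IsFrame

lemma IsFullerene.disjoint_faceVerts {V : Type*} [Fintype V] [DecidableEq V] {G : SimpleGraph V}
    {faces : Finset (Finset (Sym2 V))} (hF : IsFullerene G faces) {f f' : Finset (Sym2 V)}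
    (hf : f ∈ faces) (hf' : f' ∈ faces) (h : Disjoint f f') :
    Disjoint (faceVerts f) (faceVerts f') := by
  refine Set.disjoint_left.mpr fun v hv hv' => ?_
  obtain ⟨e, he, he', -⟩ := hF.exists_common_edge hf hf' hv hv'
  exact Finset.disjoint_left.mp h he he'

namespace IsFrame

variable {V : Type*} [Fintype V] [DecidableEq V] {G : SimpleGraph V}
  {faces : Finset (Finset (Sym2 V))} {R F : ZMod 7 → Finset (Sym2 V)} {P Q M : ZMod 7 → V}
  {l r g : ZMod 7 → Sym2 V}

lemma exists_ring_of_pattern_zero_three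
    (h : IsFrame faces R P Q M (fun i => decide (i ∈ ({0, 3} : Finset (ZMod 7)))) l r g F)
    (hF : IsFullerene G faces) : ∃ A, IsPentagonalRing faces 6 A := by
  have e₁ : F 0 = F 1 := h.F_eq 1 rfl
  have e₂ : F 0 = F 2 := e₁.trans (h.F_eq 2 rfl)
  have e₄ : F 3 = F 4 := h.F_eq 4 rfl
  have e₅ : F 3 = F 5 := e₄.trans (h.F_eq 5 rfl)
  have e₆ : F 3 = F 6 := e₅.trans (h.F_eq 6 rfl)
  have hg₀ : g 0 ∈ F 0 := h.g_mem_F 0 rfl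
  have hg₀' : g 0 ∈ F 3 := e₆ ▸ h.g_mem_F_pred 0 rfl
  have hg₃ : g 3 ∈ F 3 := h.g_mem_F 3 rfl
  have hr₀ : r 0 ∈ F 0 := h.r_mem_F 0
  have hl₁ : l 1 ∈ F 0 := h.l_mem_F 0
  have hl₂ : l 2 ∈ F 0 := e₁ ▸ h.l_mem_F 1
  have hl₃ : l 3 ∈ F 0 := e₂ ▸ h.l_mem_F 2
  have hr₃ : r 3 ∈ F 3 := h.r_mem_F 3
  have hl₄ : l 4 ∈ F 3 := h.l_mem_F 3
  have hl₅ : l 5 ∈ F 3 := e₄ ▸ h.l_mem_F 4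
  have hl₆ : l 6 ∈ F 3 := e₅ ▸ h.l_mem_F 5
  have hl₀ : l 0 ∈ F 3 := e₆ ▸ h.l_mem_F 6
  have hgg : g 0 = g 3 := by
    by_contra hne
    have := hF.length_le_six (h.F_mem 3) (L := [g 0, g 3, r 3, l 4, l 5, l 6, l 0])
      (by simp +decide [hne, h.g_ne_l hF, h.g_ne_r hF, h.r_ne_l, h.l_ne_l])
      (by simp [hr₃, hl₄, hl₅, hl₆, hl₀, hg₀', hg₃])
    simp at this
  have E₁ : r 0 = s(M 0, P 0) := h.r_of_true rfl
  have E₂ : l 1 = s(P 0, P 1) := h.l_of_false rfl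
  have E₃ : l 2 = s(P 1, P 2) := h.l_of_false rfl
  have E₄ : l 3 = s(P 2, M 3) := h.l_of_true rfl
  have E₅ : g 0 = s(M 3, M 0) :=
    (Sym2.mem_and_mem_iff (h.M_ne_M hF (i := 3) (j := 0) rfl rfl (by decide))).mp
      ⟨hgg ▸ h.M_mem_g 3 rfl, h.M_mem_g 0 rfl⟩
  have hnd : [r 0, l 1, l 2, l 3, g 0].Nodup := by
    simp +decide [(h.g_ne_l hF _ _).symm, (h.g_ne_r hF _ _).symm, h.r_ne_l, h.l_ne_l]
  have hF₀ : F 0 = [r 0, l 1, l 2, l 3, g 0].toFinset := by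
    rw [E₁, E₂, E₃, E₄, E₅] at hnd ⊢
    exact hF.eq_of_pentagon (h.F_mem 0) hnd (E₁ ▸ hr₀) (E₂ ▸ hl₁) (E₃ ▸ hl₂) (E₄ ▸ hl₃) (E₅ ▸ hg₀)
  have hF₀_iff : ∀ x, x ∈ F 0 ↔ x = r 0 ∨ x = l 1 ∨ x = l 2 ∨ x = l 3 ∨ x = g 0 := by
    simp [hF₀]
  have hgR : ∀ j, g 0 ∉ R j := h.g_notMem_R hF rfl
  have hF₀_disj : ∀ j ∈ ({4, 5, 6} : Finset (ZMod 7)),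
      Disjoint (faceVerts (F 0)) (faceVerts (R j)) := by
    intro j hj
    refine hF.disjoint_faceVerts (h.F_mem _) (h.mem _) (Finset.disjoint_left.mpr fun x hx hxj => ?_)
    rcases (hF₀_iff x).mp hx with rfl | rfl | rfl | rfl | rfl
    · simp +decide [h.r_mem_R_iff.mp hxj] at hj
    · simp +decide [h.l_mem_R_iff.mp hxj] at hj
    · simp +decide [h.l_mem_R_iff.mp hxj] at hj
    · simp +decide [h.l_mem_R_iff.mp hxj] at hj
    · exact hgR j hxj
  refine ⟨![R 0, F 0, R 3, R 4, R 5, R 6], isPentagonalRing_six ?_ ?_ ?_ ?_ ?_⟩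
  · intro i
    fin_cases i
    exacts [h.mem 0, h.F_mem 0, h.mem 3, h.mem 4, h.mem 5, h.mem 6]
  · intro i
    fin_cases i
    exacts [h.card 0, (congrArg _ hF₀).trans (List.toFinset_card_of_nodup hnd), h.card 3,
      h.card 4, h.card 5, h.card 6]
  · intro i
    fin_cases i
    · refine ⟨r 0, show R 0 ∩ F 0 = {r 0} from ?_⟩
      ext x
      simp only [Finset.mem_inter, Finset.mem_singleton]
      refine ⟨fun ⟨hxR, hxF⟩ => ?_, by rintro rfl; exact ⟨h.r_mem_R 0, hr₀⟩⟩
      rcases (hF₀_iff x).mp hxF with rfl | rfl | rfl | rfl | rfl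
      · rfl
      · exact absurd (h.l_mem_R_iff.mp hxR) (by decide)
      · exact absurd (h.l_mem_R_iff.mp hxR) (by decide)
      · exact absurd (h.l_mem_R_iff.mp hxR) (by decide)
      · exact absurd hxR (hgR 0)
    · refine ⟨l 3, show F 0 ∩ R 3 = {l 3} from ?_⟩
      ext x
      simp only [Finset.mem_inter, Finset.mem_singleton]
      refine ⟨fun ⟨hxF, hxR⟩ => ?_, by rintro rfl; exact ⟨hl₃, h.l_mem_R 3⟩⟩
      rcases (hF₀_iff x).mp hxF with rfl | rfl | rfl | rfl | rfl
      · exact absurd (h.r_mem_R_iff.mp hxR) (by decide)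
      · exact absurd (h.l_mem_R_iff.mp hxR) (by decide)
      · exact absurd (h.l_mem_R_iff.mp hxR) (by decide)
      · rfl
      · exact absurd hxR (hgR 3)
    exacts [⟨_, h.inter 3⟩, ⟨_, h.inter 4⟩, ⟨_, h.inter 5⟩, ⟨_, h.inter 6⟩]
  · intro i
    fin_cases i
    exacts [h.disj 0 3 (by decide) (by decide) (by decide), hF₀_disj 4 (by decide),
      h.disj 3 5 (by decide) (by decide) (by decide), h.disj 4 6 (by decide) (by decide) (by decide),
      h.disj 5 0 (by decide) (by decide) (by decide), (hF₀_disj 6 (by decide)).symm]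
  · intro i
    fin_cases i
    exacts [h.disj 0 4 (by decide) (by decide) (by decide), hF₀_disj 5 (by decide),
      h.disj 3 6 (by decide) (by decide) (by decide), h.disj 4 0 (by decide) (by decide) (by decide),
      (hF₀_disj 5 (by decide)).symm, h.disj 6 3 (by decide) (by decide) (by decide)]

end IsFrame

namespace IsFrame

variable {V : Type*} [Fintype V] [DecidableEq V] {G : SimpleGraph V}
  {faces : Finset (Finset (Sym2 V))} {R F : ZMod 7 → Finset (Sym2 V)} {P Q M : ZMod 7 → V}
  {l r g : ZMod 7 → Sym2 V}

lemma exists_ring_of_pattern_zero_two_four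
    (h : IsFrame faces R P Q M (fun i => decide (i ∈ ({0, 2, 4} : Finset (ZMod 7)))) l r g F)
    (hF : IsFullerene G faces) : ∃ A, IsPentagonalRing faces 6 A := by
  have e₁ : F 0 = F 1 := h.F_eq 1 rfl
  have e₃ : F 2 = F 3 := h.F_eq 3 rfl
  have e₅ : F 4 = F 5 := h.F_eq 5 rfl
  have e₆ : F 4 = F 6 := e₅.trans (h.F_eq 6 rfl)
  have n₀ : F 4 ≠ F 0 := e₆ ▸ h.F_ne 0 rfl
  have n₂ : F 0 ≠ F 2 := e₁ ▸ h.F_ne 2 rfl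
  have n₄ : F 2 ≠ F 4 := e₃ ▸ h.F_ne 4 rfl
  have hg₀ : g 0 ∈ F 0 := h.g_mem_F 0 rfl
  have hg₀' : g 0 ∈ F 4 := e₆ ▸ h.g_mem_F_pred 0 rfl
  have hg₂ : g 2 ∈ F 2 := h.g_mem_F 2 rfl
  have hg₂' : g 2 ∈ F 0 := e₁ ▸ h.g_mem_F_pred 2 rfl
  have hg₄ : g 4 ∈ F 4 := h.g_mem_F 4 rfl
  have hg₄' : g 4 ∈ F 2 := e₃ ▸ h.g_mem_F_pred 4 rfl
  have g₀₂ : g 0 ≠ g 2 :=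
    h.g_ne_g hF rfl rfl (e₆ ▸ e₁ ▸ n₀ : F 6 ≠ F 1) (e₆ ▸ n₄.symm : F 6 ≠ F 2)
  have g₂₄ : g 2 ≠ g 4 := h.g_ne_g hF rfl rfl (e₁ ▸ e₃ ▸ n₂ : F 1 ≠ F 3) (e₁ ▸ n₀.symm : F 1 ≠ F 4)
  have g₄₀ : g 4 ≠ g 0 := h.g_ne_g hF rfl rfl (e₃ ▸ e₆ ▸ n₄ : F 3 ≠ F 6) (e₃ ▸ n₂.symm : F 3 ≠ F 0)
  have hr₀ : r 0 ∈ F 0 := h.r_mem_F 0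
  have hl₁ : l 1 ∈ F 0 := h.l_mem_F 0
  have hl₂ : l 2 ∈ F 0 := e₁ ▸ h.l_mem_F 1
  have hr₂ : r 2 ∈ F 2 := h.r_mem_F 2
  have hl₃ : l 3 ∈ F 2 := h.l_mem_F 2
  have hl₄ : l 4 ∈ F 2 := e₃ ▸ h.l_mem_F 3
  have hr₄ : r 4 ∈ F 4 := h.r_mem_F 4
  have hl₅ : l 5 ∈ F 4 := h.l_mem_F 4
  have hl₆ : l 6 ∈ F 4 := e₅ ▸ h.l_mem_F 5
  have hl₀ : l 0 ∈ F 4 := e₆ ▸ h.l_mem_F 6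
  have hginj : ∀ i j : ZMod 7, i = 0 ∨ i = 2 ∨ i = 4 → j = 0 ∨ j = 2 ∨ j = 4 → g i = g j →
      i = j := by
    rintro i j (rfl | rfl | rfl) (rfl | rfl | rfl) hij <;> simp_all
  have hfree : ∀ i v, i = 0 ∨ i = 2 ∨ i = 4 → v ∈ g i → v ≠ M i → ∀ j, v ∉ l j ∧ v ∉ r j := by
    intro i v hi hv hvM j
    by_contra hj
    obtain ⟨hXj, hvj, hgj⟩ := h.eq_of_mem_g hF (i := i) (j := j) (by simpa using hi) hv (by tauto)
    obtain rfl := hginj i j hi (by simpa using hXj) hgj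
    exact hvM hvj
  obtain ⟨v, hgv, hvM⟩ := h.exists_eq_g hF (i := 4) rfl
  have hv₄ : v ∈ g 4 := by simp [hgv]
  have hvfree := hfree 4 v (by simp) hv₄ hvM
  have hv₀ : v ∈ g 0 := by
    obtain ⟨x, hx, hx₄, hvx, -⟩ := hF.exists_other_edge (h.F_mem 4) hg₄ hv₄
    have hxL := hF.mem_of_length_eq_six (h.F_mem 4) (L := [g 4, g 0, r 4, l 5, l 6, l 0])
      (by simp +decide [g₄₀, h.g_ne_l hF, h.g_ne_r hF, h.r_ne_l, h.l_ne_l])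
      (by simp [hr₄, hl₅, hl₆, hl₀, hg₄, hg₀']) rfl hx
    simp only [List.mem_cons, List.not_mem_nil, or_false] at hxL
    rcases hxL with rfl | rfl | rfl | rfl | rfl | rfl
    · exact absurd rfl hx₄
    · exact hvx
    all_goals simp [hvfree] at hvx
  have E₀ : g 0 = s(M 0, v) := h.g_eq_of_mem rfl hv₀ (hvfree 0).1
  have hv₂ : v ∈ g 2 := by
    by_contra hv₂
    obtain ⟨k, -, -, hk₀, hk₄, hall⟩ := hF.exists_third_edge (hF.mem_edgeSet (h.F_mem 0) hg₀)
      (hF.mem_edgeSet (h.F_mem 4) hg₄) hv₀ hv₄ g₄₀.symm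
    have hk : k ∈ F 0 ∧ v ∈ k := by
      obtain ⟨x, hx, hx₀, hvx, -⟩ := hF.exists_other_edge (h.F_mem 0) hg₀ hv₀
      rcases hall x (hF.mem_edgeSet (h.F_mem 0) hx) hvx with rfl | rfl | rfl
      · exact absurd rfl hx₀
      · rcases h.F_eq_of_g_mem hF rfl (h.F_mem 0) hx with h' | h'
        · exact absurd h' (e₃ ▸ n₂ : F 0 ≠ F 3)
        · exact absurd h'.symm n₀
      · exact ⟨hx, hvx⟩
    have hk' : k ∈ F 2 := by
      obtain ⟨x, hx, hx₀, hvx, -⟩ := hF.exists_other_edge (h.F_mem 2) hg₄' hv₄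
      rcases hall x (hF.mem_edgeSet (h.F_mem 2) hx) hvx with rfl | rfl | rfl
      · rcases h.F_eq_of_g_mem hF rfl (h.F_mem 2) hx with h' | h'
        · exact absurd h' (e₆ ▸ n₄ : F 2 ≠ F 6)
        · exact absurd h'.symm n₂
      · exact absurd rfl hx₀
      · exact hx
    have hkl : ∀ j, k ≠ l j := fun j hj => (hvfree j).1 (hj ▸ hk.2)
    have hkr : ∀ j, k ≠ r j := fun j hj => (hvfree j).2 (hj ▸ hk.2)
    have hk₂ : g 2 ≠ k := fun hj => hv₂ (hj ▸ hk.2)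
    obtain ⟨w, hgw, hwM⟩ := h.exists_eq_g hF (i := 2) rfl
    have hw : w ∈ g 2 := by simp [hgw]
    have hwfree := hfree 2 w (by simp) hw hwM
    obtain ⟨x, hx, hx₂, hwx, -⟩ := hF.exists_other_edge (h.F_mem 0) hg₂' hw
    have hxL := hF.mem_of_length_eq_six (h.F_mem 0) (L := [g 0, g 2, k, r 0, l 1, l 2])
      (by simp +decide [g₀₂, hk₀.symm, hk₂, hkl, hkr, h.g_ne_l hF, h.g_ne_r hF, h.r_ne_l, h.l_ne_l])
      (by simp [hr₀, hl₁, hl₂, hg₀, hg₂', hk.1]) rfl hx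
    simp only [List.mem_cons, List.not_mem_nil, or_false] at hxL
    rcases hxL with rfl | rfl | rfl | rfl | rfl | rfl
    · rw [E₀, Sym2.mem_iff] at hwx
      rcases hwx with rfl | rfl
      · exact (hwfree 0).1 (h.M_mem_l rfl)
      · exact hv₂ hw
    · exact hx₂ rfl
    · exact n₂ (hF.corner_unique hw hwx hk₂ (h.F_mem 0) (h.F_mem 2) hg₂' hx hg₂ hk')
    all_goals simp [hwfree] at hwx
  have E₂ : g 2 = s(M 2, v) := h.g_eq_of_mem rfl hv₂ (hvfree 2).1
  have E₂' : g 2 = s(v, M 2) := E₂.trans Sym2.eq_swap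
  have E₄ : g 4 = s(M 4, v) := hgv
  have E₀' : g 0 = s(v, M 0) := E₀.trans Sym2.eq_swap
  have A₁ : r 0 = s(M 0, P 0) := h.r_of_true rfl
  have A₂ : l 1 = s(P 0, P 1) := h.l_of_false rfl
  have A₃ : l 2 = s(P 1, M 2) := h.l_of_true rfl
  have B₁ : r 2 = s(M 2, P 2) := h.r_of_true rfl
  have B₂ : l 3 = s(P 2, P 3) := h.l_of_false rfl
  have B₃ : l 4 = s(P 3, M 4) := h.l_of_true rfl
  have hnd₀ : [r 0, l 1, l 2, g 2, g 0].Nodup := by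
    simp +decide [g₀₂.symm, (h.g_ne_l hF _ _).symm, (h.g_ne_r hF _ _).symm, h.r_ne_l, h.l_ne_l]
  have hF₀ : F 0 = [r 0, l 1, l 2, g 2, g 0].toFinset := by
    rw [A₁, A₂, A₃, E₂, E₀'] at hnd₀ ⊢
    exact hF.eq_of_pentagon (h.F_mem 0) hnd₀ (A₁ ▸ hr₀) (A₂ ▸ hl₁) (A₃ ▸ hl₂) (E₂ ▸ hg₂')
      (E₀' ▸ hg₀)
  have hnd₂ : [r 2, l 3, l 4, g 4, g 2].Nodup := by
    simp +decide [g₂₄.symm, (h.g_ne_l hF _ _).symm, (h.g_ne_r hF _ _).symm, h.r_ne_l, h.l_ne_l]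
  have hF₂ : F 2 = [r 2, l 3, l 4, g 4, g 2].toFinset := by
    rw [B₁, B₂, B₃, E₄, E₂'] at hnd₂ ⊢
    exact hF.eq_of_pentagon (h.F_mem 2) hnd₂ (B₁ ▸ hr₂) (B₂ ▸ hl₃) (B₃ ▸ hl₄) (E₄ ▸ hg₄')
      (E₂' ▸ hg₂)
  have hF₀_iff : ∀ x, x ∈ F 0 ↔ x = r 0 ∨ x = l 1 ∨ x = l 2 ∨ x = g 2 ∨ x = g 0 := by
    simp [hF₀]
  have hF₂_iff : ∀ x, x ∈ F 2 ↔ x = r 2 ∨ x = l 3 ∨ x = l 4 ∨ x = g 4 ∨ x = g 2 := by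
    simp [hF₂]
  have hgR₀ : ∀ j, g 0 ∉ R j := h.g_notMem_R hF rfl
  have hgR₂ : ∀ j, g 2 ∉ R j := h.g_notMem_R hF rfl
  have hgR₄ : ∀ j, g 4 ∉ R j := h.g_notMem_R hF rfl
  have hF₀_disj : ∀ j ∈ ({4, 5, 6} : Finset (ZMod 7)),
      Disjoint (faceVerts (F 0)) (faceVerts (R j)) := by
    intro j hj
    refine hF.disjoint_faceVerts (h.F_mem _) (h.mem _) (Finset.disjoint_left.mpr fun x hx hxj => ?_)
    rcases (hF₀_iff x).mp hx with rfl | rfl | rfl | rfl | rfl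
    · simp +decide [h.r_mem_R_iff.mp hxj] at hj
    · simp +decide [h.l_mem_R_iff.mp hxj] at hj
    · simp +decide [h.l_mem_R_iff.mp hxj] at hj
    · exact hgR₂ j hxj
    · exact hgR₀ j hxj
  have hF₂_disj : ∀ j ∈ ({0, 5, 6} : Finset (ZMod 7)),
      Disjoint (faceVerts (F 2)) (faceVerts (R j)) := by
    intro j hj
    refine hF.disjoint_faceVerts (h.F_mem _) (h.mem _) (Finset.disjoint_left.mpr fun x hx hxj => ?_)
    rcases (hF₂_iff x).mp hx with rfl | rfl | rfl | rfl | rfl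
    · simp +decide [h.r_mem_R_iff.mp hxj] at hj
    · simp +decide [h.l_mem_R_iff.mp hxj] at hj
    · simp +decide [h.l_mem_R_iff.mp hxj] at hj
    · exact hgR₄ j hxj
    · exact hgR₂ j hxj
  refine ⟨![R 0, F 0, F 2, R 4, R 5, R 6], isPentagonalRing_six ?_ ?_ ?_ ?_ ?_⟩
  · intro i
    fin_cases i
    exacts [h.mem 0, h.F_mem 0, h.F_mem 2, h.mem 4, h.mem 5, h.mem 6]
  · intro i
    fin_cases i
    exacts [h.card 0, (congrArg _ hF₀).trans (List.toFinset_card_of_nodup hnd₀),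
      (congrArg _ hF₂).trans (List.toFinset_card_of_nodup hnd₂), h.card 4, h.card 5, h.card 6]
  · intro i
    fin_cases i
    · refine ⟨r 0, show R 0 ∩ F 0 = {r 0} from ?_⟩
      ext x
      simp only [Finset.mem_inter, Finset.mem_singleton]
      refine ⟨fun ⟨hxR, hxF⟩ => ?_, by rintro rfl; exact ⟨h.r_mem_R 0, hr₀⟩⟩
      rcases (hF₀_iff x).mp hxF with rfl | rfl | rfl | rfl | rfl
      · rfl
      · exact absurd (h.l_mem_R_iff.mp hxR) (by decide)
      · exact absurd (h.l_mem_R_iff.mp hxR) (by decide)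
      · exact absurd hxR (hgR₂ 0)
      · exact absurd hxR (hgR₀ 0)
    · refine ⟨g 2, show F 0 ∩ F 2 = {g 2} from ?_⟩
      ext x
      simp only [Finset.mem_inter, Finset.mem_singleton]
      refine ⟨fun ⟨hx₀, hx₂⟩ => ?_, by rintro rfl; exact ⟨hg₂', hg₂⟩⟩
      rw [hF₂_iff] at hx₂
      rcases (hF₀_iff x).mp hx₀ with rfl | rfl | rfl | rfl | rfl
      · simp +decide [h.r_ne_r, h.r_ne_l, (h.g_ne_r hF _ _).symm] at hx₂
      · simp +decide [(h.r_ne_l _).symm, h.l_ne_l, (h.g_ne_l hF _ _).symm] at hx₂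
      · have : r 2 ≠ l 2 := (h.l_ne_r rfl).symm
        simp +decide [this.symm, h.l_ne_l, (h.g_ne_l hF _ _).symm] at hx₂
      · rfl
      · simp +decide [h.g_ne_r hF, h.g_ne_l hF, g₄₀.symm, g₀₂] at hx₂
    · refine ⟨l 4, show F 2 ∩ R 4 = {l 4} from ?_⟩
      ext x
      simp only [Finset.mem_inter, Finset.mem_singleton]
      refine ⟨fun ⟨hxF, hxR⟩ => ?_, by rintro rfl; exact ⟨hl₄, h.l_mem_R 4⟩⟩
      rcases (hF₂_iff x).mp hxF with rfl | rfl | rfl | rfl | rfl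
      · exact absurd (h.r_mem_R_iff.mp hxR) (by decide)
      · exact absurd (h.l_mem_R_iff.mp hxR) (by decide)
      · rfl
      · exact absurd hxR (hgR₄ 4)
      · exact absurd hxR (hgR₂ 4)
    exacts [⟨_, h.inter 4⟩, ⟨_, h.inter 5⟩, ⟨_, h.inter 6⟩]
  · intro i
    fin_cases i
    exacts [(hF₂_disj 0 (by decide)).symm, hF₀_disj 4 (by decide), hF₂_disj 5 (by decide),
      h.disj 4 6 (by decide) (by decide) (by decide),
      h.disj 5 0 (by decide) (by decide) (by decide), (hF₀_disj 6 (by decide)).symm]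
  · intro i
    fin_cases i
    exacts [h.disj 0 4 (by decide) (by decide) (by decide), hF₀_disj 5 (by decide),
      hF₂_disj 6 (by decide), h.disj 4 0 (by decide) (by decide) (by decide),
      (hF₀_disj 5 (by decide)).symm, (hF₂_disj 6 (by decide)).symm]

end IsFrame

/-- A belt whose fifth vertices follow one of the listed patterns yields a ring of six. -/
lemma IsBelt.exists_ring_six {V : Type*} [Fintype V] [DecidableEq V] {G : SimpleGraph V}
    {faces : Finset (Finset (Sym2 V))} (hF : IsFullerene G faces)
    {R : ZMod 7 → Finset (Sym2 V)} {P Q M : ZMod 7 → V} {X : ZMod 7 → Bool}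
    (h : IsBelt faces R P Q M X)
    (hX : (∀ i ∈ ({1, 2, 3, 4} : Finset (ZMod 7)), X i = false) ∨
      ∃ s ∈ ({{0, 3}, {0, 4, 6}, {0, 4, 5}, {0, 3, 6}, {0, 2, 4}} : Finset (Finset (ZMod 7))),
        ∀ i, X i = decide (i ∈ s)) : ∃ A, IsPentagonalRing faces 6 A := by
  obtain ⟨l, r, g, F, hf⟩ := hF.exists_isFrame h
  rcases hX with hX | ⟨s, hs, hX⟩
  · exact (hf.not_run hF hX).elim
  obtain rfl : X = fun i => decide (i ∈ s) := funext hX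
  simp only [Finset.mem_insert, Finset.mem_singleton] at hs
  rcases hs with rfl | rfl | rfl | rfl | rfl
  · exact hf.exists_ring_of_pattern_zero_three hF
  · have e₅ : F 4 = F 5 := hf.F_eq 5 rfl
    have n₆ : F 5 ≠ F 6 := hf.F_ne 6 rfl
    exact (hf.not_gap_four hF (by decide) rfl rfl (e₅ ▸ n₆.symm)).elim
  · have e₆ : F 5 = F 6 := hf.F_eq 6 rfl
    have n₅ : F 4 ≠ F 5 := hf.F_ne 5 rfl
    exact (hf.not_gap_four hF (by decide) rfl rfl (e₆ ▸ n₅.symm)).elim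
  · exact (hf.not_pattern_zero_three_six hF).elim
  · exact hf.exists_ring_of_pattern_zero_two_four hF

/-- no fullerene graph has minimum pentagonal ring length exactly 7:
a fullerene graph with a pentagonal ring of length 7 also has one of length at
most 6. -/
theorem no_tau_seven {V : Type*} [Fintype V] [DecidableEq V]
    (G : SimpleGraph V) (faces : Finset (Finset (Sym2 V)))
    (hF : IsFullerene G faces)
    (ring : ZMod 7 → Finset (Sym2 V)) (hring : IsPentagonalRing faces 7 ring) :
    ∃ (l : ℕ) (ring' : ZMod l → Finset (Sym2 V)),
      IsPentagonalRing faces l ring' ∧ l ≤ 6 := by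
  obtain ⟨P, Q, M, X, hB⟩ := hF.exists_isBelt hring
  obtain ⟨b, c, hX⟩ := exists_side_pattern X
  obtain ⟨A, hA⟩ : ∃ A, IsPentagonalRing faces 6 A := by
    cases b
    · exact (hB.rotate c).exists_ring_six hF (by simpa using hX)
    · exact (hB.swap.rotate c).exists_ring_six hF (by simpa using hX)
  exact ⟨6, A, hA, le_rfl⟩
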